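/- Let m be a multisegment and [a,b] a segment with a < b, and suppose D_{[a+1]}(m) ≠ ∞. Then: (i) if D^Lang_{[a,b]}(m) ≠ ∞, then D_{[a+1]}(D^Lang_{[a,b]}(m)) = D^Lang_{[a,b]}(D_{[a+1]}(m)) and this common value is ≠ ∞; (ii) if D^Lang_{[a,b]}(D_{[a+1]}(m)) ≠ ∞, then D^Lang_{[a,b]}(m) ≠ ∞. -/

import Mathlib

namespace Multiseg

/-- A segment `[a,b]` on a fixed cuspidal line, encoded by its endpoints. -/
abbrev Seg := ℤ × ℤ

/-- A multiset of pairs is a multisegment when each pair is a genuine segment. -/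
def IsMS (m : Multiset Seg) : Prop := ∀ Δ ∈ m, Δ.1 ≤ Δ.2

/-- `Δ ≺ Δ'` : the segment `Δ` precedes `Δ'`. -/
def Prec (Δ Δ' : Seg) : Prop := Δ.1 < Δ'.1 ∧ Δ.2 < Δ'.2 ∧ Δ'.1 ≤ Δ.2 + 1

instance : DecidableRel Prec := fun _ _ => by unfold Prec; infer_instance

/-- `Δ ⊆ Δ'` as segments. -/
def SSub (Δ Δ' : Seg) : Prop := Δ'.1 ≤ Δ.1 ∧ Δ.2 ≤ Δ'.2

/-- `m[i]`, the segments of `m` starting at `i`. -/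
def startAt (m : Multiset Seg) (i : ℤ) : Multiset Seg := m.filter fun Δ => Δ.1 = i

/-- `m⟨i⟩`, the segments of `m` ending at `i`. -/
def endAt (m : Multiset Seg) (i : ℤ) : Multiset Seg := m.filter fun Δ => Δ.2 = i

/-- `m_{[a,b]} = {[a',b'] ∈ m : a ≤ a' ≤ b+1 ≤ b'+1}`. -/
def mRange (m : Multiset Seg) (a b : ℤ) : Multiset Seg :=
  m.filter fun Δ => a ≤ Δ.1 ∧ Δ.1 ≤ b + 1 ∧ b ≤ Δ.2

/-- Add the segment `[x,y]` to `m`, discarding it if it is void. -/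
def pushSeg (m : Multiset Seg) (x y : ℤ) : Multiset Seg :=
  if x ≤ y then m + {(x, y)} else m

def msetMax (s : Multiset ℤ) : Option ℤ :=
  if h : s = 0 then none else some (s.toFinset.max' (Multiset.toFinset_nonempty.mpr h))

def msetMin (s : Multiset ℤ) : Option ℤ :=
  if h : s = 0 then none else some (s.toFinset.min' (Multiset.toFinset_nonempty.mpr h))

/-- The longest segment of `m[i]`, if any. -/
def longStart (m : Multiset Seg) (i : ℤ) : Option Seg :=
  (msetMax ((startAt m i).map Prod.snd)).map fun y => (i, y)

/-- The shortest segment of `m[i]`, if any. -/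
def shortStart (m : Multiset Seg) (i : ℤ) : Option Seg :=
  (msetMin ((startAt m i).map Prod.snd)).map fun y => (i, y)

/-- The longest segment of `m⟨i⟩`, if any. -/
def longEnd (m : Multiset Seg) (i : ℤ) : Option Seg :=
  (msetMin ((endAt m i).map Prod.fst)).map fun x => (x, i)

/-- The shortest segment of `m⟨i⟩`, if any. -/
def shortEnd (m : Multiset Seg) (i : ℤ) : Option Seg :=
  (msetMax ((endAt m i).map Prod.fst)).map fun x => (x, i)

/-- One removal step of the `tds(·,c)` process: remove the longest segment `Δ''`
of `m[c+1]` and the longest segment `Δ'` of `m[c]` with `Δ' ≺ Δ''`. -/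
def tdsStep (m : Multiset Seg) (c : ℤ) : Option (Multiset Seg) :=
  match longStart m (c + 1) with
  | none => none
  | some Δ'' =>
    match msetMax (((startAt m c).filter fun Δ => Prec Δ Δ'').map Prod.snd) with
    | none => none
    | some y => some ((m.erase (c, y)).erase Δ'')

def tdsIterF (c : ℤ) : ℕ → Multiset Seg → Multiset Seg
  | 0, m => m
  | n + 1, m =>
    match tdsStep m c with
    | none => m
    | some m' => tdsIterF c n m'

/-- Iterate the `tds(·,c)` process until it terminates. -/
def tdsIter (c : ℤ) (m : Multiset Seg) : Multiset Seg := tdsIterF c m.card m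

/-- The `ρ`-derivative algorithm `𝒟_{[a]}`; the value `none` codes `∞`. -/
def Drho (a : ℤ) (m : Multiset Seg) : Option (Multiset Seg) :=
  (shortStart (tdsIter a m) a).map fun Δ => pushSeg (m.erase Δ) (a + 1) Δ.2

/-- `ε_{[a]}(m)`, the number of segments starting at `a` left after the
`tds(·,a)` process terminates. -/
def epsA (a : ℤ) (m : Multiset Seg) : ℕ := (startAt (tdsIter a m) a).card

/-- The next element of an upward sequence after `p`. -/
def usNext (n : Multiset Seg) (p : Seg) : Option Seg :=
  match msetMin ((n.filter fun Δ => Prec p Δ).map Prod.fst) with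
  | none => none
  | some aj =>
    (msetMax ((((n.filter fun Δ => Prec p Δ).filter fun Δ => Δ.1 = aj)).map Prod.snd)).map
      fun y => (aj, y)

def usAux (n : Multiset Seg) : ℕ → Seg → List Seg
  | 0, _ => []
  | fuel + 1, p =>
    match usNext n p with
    | none => []
    | some Δ => Δ :: usAux n fuel Δ

/-- The upward sequence `Us(n)` of maximally linked segments of `n`. -/
def usList (n : Multiset Seg) : List Seg :=
  match msetMin (n.map Prod.fst) with
  | none => []
  | some a1 =>
    match longStart n a1 with
    | none => []
    | some Δ1 => Δ1 :: usAux n n.card Δ1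

/-- The decomposition of a multisegment into successive upward sequences. -/
def usDecomp : ℕ → Multiset Seg → List (List Seg)
  | 0, _ => []
  | fuel + 1, n =>
    if n = 0 then [] else usList n :: usDecomp fuel (n - (usList n : Multiset Seg))

/-- `[x,y] ⊆ [u,v]` (with the void interval contained in anything). -/
def intSubB (x y u v : ℤ) : Bool := decide (y < x) || (decide (u ≤ x) && decide (y ≤ v))

/-- Find, in a row of an upward-sequence decomposition, the first segment `Δ`
whose removable free section contains `[s(Δ), top]`. -/
def findRowD : List Seg → ℤ → Option Seg
  | [], _ => none
  | [Δ], top => if intSubB Δ.1 top Δ.1 Δ.2 then some Δ else none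
  | Δ :: Δ' :: rest, top =>
    if intSubB Δ.1 top Δ.1 (Δ'.1 - 2) then some Δ else findRowD (Δ' :: rest) top

/-- The selection step of the Langlands derivative algorithm, scanning the rows
downwards from the last one; it records each selected segment together with the
start of its truncation. -/
def selAuxD (rows : List (List Seg)) : ℕ → ℤ → List (Seg × ℤ)
  | 0, _ => []
  | n + 1, top =>
    match findRowD (rows.getD n []) top with
    | some Δ => (Δ, top + 1) :: selAuxD rows n (Δ.1 - 1)
    | none => selAuxD rows n top

/-- The Langlands derivative algorithm `𝒟^Lang_{[a,b]}`; `none` codes `∞`. -/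
def DLang (a b : ℤ) (m : Multiset Seg) : Option (Multiset Seg) :=
  let m1 := mRange m a b
  let rows := usDecomp m1.card m1
  let sel := selAuxD rows rows.length b
  match sel.getLast? with
  | none => none
  | some (Δl, _) =>
    if Δl.1 = a then
      some (sel.foldl (fun acc p => pushSeg (acc.erase p.1) p.2 p.1.2) m)
    else none

/-- One removal step of the `tus(·,c)` process. -/
def tusStep (n : Multiset Seg) (c : ℤ) : Option (Multiset Seg) :=
  match shortStart n c with
  | none => none
  | some Δ' =>
    match msetMin (((startAt n (c + 1)).filter fun Δ => Prec Δ' Δ).map Prod.snd) with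
    | none => none
    | some y => some ((n.erase Δ').erase (c + 1, y))

def tusIterF (c : ℤ) : ℕ → Multiset Seg → Multiset Seg
  | 0, n => n
  | k + 1, n =>
    match tusStep n c with
    | none => n
    | some n' => tusIterF c k n'

/-- Iterate the `tus(·,c)` process until it terminates. -/
def tusIter (c : ℤ) (n : Multiset Seg) : Multiset Seg := tusIterF c n.card n

/-- The `ρ`-integral algorithm `ℐ_{[a]}` (always defined). -/
def Irho (a : ℤ) (n : Multiset Seg) : Multiset Seg :=
  match longStart (tusIter a n) (a + 1) with
  | none => n + {(a, a)}
  | some Δ => pushSeg (n.erase Δ) a Δ.2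

/-- The next element of a downward sequence after `p`. -/
def dsNext (n : Multiset Seg) (p : Seg) : Option Seg :=
  match msetMax ((n.filter fun Δ => Prec Δ p).map Prod.fst) with
  | none => none
  | some aq => shortStart n aq

def dsAux (n : Multiset Seg) : ℕ → Seg → List Seg
  | 0, _ => []
  | k + 1, p =>
    match dsNext n p with
    | none => []
    | some Δ => Δ :: dsAux n k Δ

/-- The downward sequence `Ds(n)` of minimal linked segments with the largest
starting. -/
def dsList (n : Multiset Seg) : List Seg :=
  match msetMax (n.map Prod.fst) with
  | none => []
  | some a1 =>
    match shortStart n a1 with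
    | none => []
    | some Δ1 => Δ1 :: dsAux n n.card Δ1

/-- The decomposition of a multisegment into successive downward sequences. -/
def dsDecomp : ℕ → Multiset Seg → List (List Seg)
  | 0, _ => []
  | k + 1, n =>
    if n = 0 then [] else dsList n :: dsDecomp k (n - (dsList n : Multiset Seg))

/-- Find, in a row of a downward-sequence decomposition, the segment whose set
of addable free points contains `pt`. -/
def findRowI (a : ℤ) : List Seg → ℤ → Option Seg
  | [], _ => none
  | [Δ], pt => if decide (a ≤ pt) && decide (pt ≤ Δ.1 - 1) then some Δ else none
  | Δ :: Δ' :: rest, pt =>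
    if decide (Δ'.1 + 1 ≤ pt) && decide (pt ≤ Δ.1 - 1) then some Δ
    else findRowI a (Δ' :: rest) pt

/-- The selection step of the Langlands integral algorithm; it records each
selected segment together with the start of its extension. -/
def selAuxI (a : ℤ) (rows : List (List Seg)) : ℕ → ℤ → List (Seg × ℤ)
  | 0, _ => []
  | n + 1, pt =>
    match findRowI a (rows.getD n []) pt with
    | some Δ => (Δ, pt) :: selAuxI a rows n Δ.1
    | none => selAuxI a rows n pt

/-- The Langlands integral algorithm `ℐ^Lang_{[a,b]}`. -/
def ILang (a b : ℤ) (m : Multiset Seg) : Multiset Seg :=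
  let m1 := mRange m a b
  let rows := dsDecomp m1.card m1
  let sel := selAuxI a rows rows.length a
  let base := sel.foldl (fun acc p => pushSeg (acc.erase p.1) p.2 p.1.2) m
  match sel.getLast? with
  | none => pushSeg base a b
  | some (Δl, _) => pushSeg base Δl.1 b

/-- `m` is in good range for `[a,b]`. -/
def GoodRange (m : Multiset Seg) (a b : ℤ) : Prop := mRange m a b = m

/-- `Θ`, the Gelfand–Kazhdan involution on multisegments. -/
def Theta (m : Multiset Seg) : Multiset Seg := m.map fun Δ => (-Δ.2, -Δ.1)

/-- The exotic duality `𝔻_r`. -/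
def Dual (r : ℤ) (m : Multiset Seg) : Multiset Seg :=
  m.map fun Δ => (-r + Δ.2 + 1, Δ.1 - 1)

/-- `𝔻_r^{[a,b]}`. -/
def DualAB (r a b : ℤ) (m : Multiset Seg) : Multiset Seg := Dual r m + {(b - r + 1, b)}

/-- The left Langlands derivative algorithm `𝒟^{Lang,L}_{[a,b]}`. -/
def DLangL (a b : ℤ) (m : Multiset Seg) : Option (Multiset Seg) :=
  (DLang (-b) (-a) (Theta m)).map Theta

/-- The left `ρ`-derivative algorithm `𝒟^{Lang,L}_{[a]}`. -/
def DrhoL (a : ℤ) (m : Multiset Seg) : Option (Multiset Seg) :=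
  (Drho (-a) (Theta m)).map Theta

/-- The next segment chosen by the MW algorithm after `p`. -/
def mwNext (m : Multiset Seg) (p : Seg) : Option Seg :=
  (msetMax (((endAt m (p.2 - 1)).filter fun Δ => Prec Δ p).map Prod.fst)).map
    fun x => (x, p.2 - 1)

def mwAux (m : Multiset Seg) : ℕ → Seg → List Seg
  | 0, _ => []
  | k + 1, p =>
    match mwNext m p with
    | none => []
    | some Δ => Δ :: mwAux m k Δ

/-- The ordered segments participating in the MW algorithm for `m`. -/
def mwList (m : Multiset Seg) : List Seg :=
  match msetMax (m.map Prod.snd) with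
  | none => []
  | some b0 =>
    match shortEnd m b0 with
    | none => []
    | some Δ0 => Δ0 :: mwAux m m.card Δ0

/-- `𝒟^MW(m)`. -/
def DMW (m : Multiset Seg) : Multiset Seg :=
  (mwList m).foldl (fun acc Δ => pushSeg (acc.erase Δ) Δ.1 (Δ.2 - 1)) m

/-- The first segment `Δ(m)` produced by the MW algorithm for `m`. -/
def mwFirstSeg (m : Multiset Seg) : Option Seg :=
  match (mwList m).head?, (mwList m).getLast? with
  | some Δ0, some Δk => some (Δk.1, Δ0.2)
  | _, _ => none

/-- The total relative length of a multisegment. -/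
def totalLen (m : Multiset Seg) : ℕ := (m.map fun Δ => (Δ.2 - Δ.1 + 1).toNat).sum

def sharpAux : ℕ → Multiset Seg → Multiset Seg
  | 0, _ => 0
  | k + 1, m =>
    if m = 0 then 0
    else
      match mwFirstSeg m with
      | none => 0
      | some Δ => Δ ::ₘ sharpAux k (DMW m)

/-- The Mœglin–Waldspurger involution `m^#`. -/
def msharp (m : Multiset Seg) : Multiset Seg := sharpAux (totalLen m) m

/-- `ε^MW_{[a,c]}(m)`, the multiplicity of `[a,c]` in `m^#`. -/
def epsMW (a c : ℤ) (m : Multiset Seg) : ℕ := (msharp m).count (a, c)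

/-- `m_i`: remove from `m` the participants of the first `i` runs of the MW
algorithm. -/
def mwStage (m : Multiset Seg) : ℕ → Multiset Seg
  | 0 => m
  | i + 1 => mwStage m i - (mwList (DMW^[i] m) : Multiset Seg)

/-- `MW_k(m)`: all segments ending at `k` participating in the first `r` runs
of the MW algorithm. -/
def MWkSet (m : Multiset Seg) (r : ℕ) (k : ℤ) : Multiset Seg :=
  ∑ i ∈ Finset.range r, (mwList (DMW^[i] m) : Multiset Seg).filter fun Δ => Δ.2 = k

def upNbrAux (m : Multiset Seg) : ℕ → Seg → Option (List Seg)
  | 0, p => some [p]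
  | k + 1, p =>
    match msetMin (((endAt m (p.2 + 1)).filter fun Δ => Prec p Δ).map Prod.fst) with
    | none => none
    | some x => (upNbrAux m k (x, p.2 + 1)).map fun l => p :: l

/-- The removal upward sequence of maximal linked segments in neighbors on `m`
ranging from `a-1` to `b` (if it exists). -/
def upSeqNbr (m : Multiset Seg) (a b : ℤ) : Option (List Seg) :=
  match longEnd m (a - 1) with
  | none => none
  | some Δ => upNbrAux m (b - (a - 1)).toNat Δ

def zelRemF (a b : ℤ) : ℕ → Multiset Seg → Multiset Seg
  | 0, m => m
  | k + 1, m =>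
    match upSeqNbr m a b with
    | none => m
    | some l => zelRemF a b k (m - (l : Multiset Seg))

/-- Repeatedly remove removal upward sequences of maximal linked segments in
neighbors ranging from `a-1` to `b`, until none exists. -/
def zelRem (a b : ℤ) (m : Multiset Seg) : Multiset Seg := zelRemF a b m.card m

def zelRemCountF (a b : ℤ) : ℕ → Multiset Seg → ℕ
  | 0, _ => 0
  | k + 1, m =>
    match upSeqNbr m a b with
    | none => 0
    | some l => zelRemCountF a b k (m - (l : Multiset Seg)) + 1

/-- The number of removal upward sequences of maximal linked segments in
neighbors ranging from `a-1` to `b` successively removed from `m`. -/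
def zelRemCount (a b : ℤ) (m : Multiset Seg) : ℕ := zelRemCountF a b m.card m

def downNbrAux (m : Multiset Seg) : ℕ → Seg → Option (List Seg)
  | 0, p => some [p]
  | k + 1, p =>
    match msetMax (((endAt m (p.2 - 1)).filter fun Δ => Prec Δ p).map Prod.fst) with
    | none => none
    | some x => (downNbrAux m k (x, p.2 - 1)).map fun l => p :: l

/-- The Zelevinsky derivative algorithm `𝒟^Zel_{[a,b]}`; `none` codes `∞`. -/
def DZel (a b : ℤ) (m : Multiset Seg) : Option (Multiset Seg) :=
  match shortEnd (zelRem a b m) b with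
  | none => none
  | some Δb =>
    match downNbrAux (zelRem a b m) (b - a).toNat Δb with
    | none => none
    | some l => some (l.foldl (fun acc Δ => pushSeg (acc.erase Δ) Δ.1 (Δ.2 - 1)) m)

/-- The downward sequence of minimal linked segments in neighbors on `m`
ranging from `b` to `a-1` (if it exists). -/
def downSeqNbr (m : Multiset Seg) (a b : ℤ) : Option (List Seg) :=
  match shortEnd m b with
  | none => none
  | some Δ => downNbrAux m (b - (a - 1)).toNat Δ

def izRemF (a b : ℤ) : ℕ → Multiset Seg → Multiset Seg
  | 0, m => m
  | k + 1, m =>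
    match downSeqNbr m a b with
    | none => m
    | some l => izRemF a b k (m - (l : Multiset Seg))

/-- Repeatedly remove downward sequences of minimal linked segments in
neighbors ranging from `b` to `a-1`, until none exists. -/
def izRem (a b : ℤ) (m : Multiset Seg) : Multiset Seg := izRemF a b m.card m

def extNext (m : Multiset Seg) (p : Seg) : Option Seg :=
  (msetMin (((endAt m (p.2 + 1)).filter fun Δ => Prec p Δ).map Prod.fst)).map
    fun x => (x, p.2 + 1)

def extAux (m : Multiset Seg) : ℕ → Option Seg → List (Option Seg)
  | 0, _ => []
  | k + 1, p =>
    let cur := p.bind (extNext m)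
    cur :: extAux m k cur

/-- The (possibly void) segments `Δ̃_{a-1}, …, Δ̃_{b-1}` participating in the
extension process of the Zelevinsky integral algorithm on `m`. -/
def extList (m : Multiset Seg) (a b : ℤ) : List (Option Seg) :=
  longEnd m (a - 1) :: extAux m (b - a).toNat (longEnd m (a - 1))

def applyExt : Multiset Seg → ℤ → List (Option Seg) → Multiset Seg
  | acc, _, [] => acc
  | acc, i, some Δ :: rest => applyExt (pushSeg (acc.erase Δ) Δ.1 (Δ.2 + 1)) (i + 1) rest
  | acc, i, none :: rest => applyExt (acc + {(i + 1, i + 1)}) (i + 1) rest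

/-- The Zelevinsky integral algorithm `ℐ^Zel_{[a,b]}`. -/
def IZel (a b : ℤ) (m : Multiset Seg) : Multiset Seg :=
  applyExt m (a - 1) (extList (izRem a b m) a b)

/-- `Δ̃⁺` for a possibly void `Δ̃` at position `i` (for the void segment at
position `i` this is the singleton `[i+1,i+1]`). -/
def plusAt (i : ℤ) : Option Seg → Seg
  | some Δ => (Δ.1, Δ.2 + 1)
  | none => (i + 1, i + 1)

def plusList : ℤ → List (Option Seg) → List Seg
  | _, [] => []
  | i, o :: rest => plusAt i o :: plusList (i + 1) rest

/-- `n₁` and `n₂` are linked by mapping: there is an injective map `f : n₁ → n₂`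
with `Δ ≺ f(Δ)` for all `Δ ∈ n₁`. -/
def LinkedByMapping (n₁ n₂ : Multiset Seg) : Prop :=
  ∃ n₂' ≤ n₂, Multiset.Rel Prec n₁ n₂'

def startsSorted (n : Multiset Seg) : List ℤ := (n.map Prod.fst).sort (· ≤ ·)

/-- `n₁' < n₁` for multisegments of segments ending at a common point, compared
via their sorted lists of starting points. -/
def MSLtStarts (n₁' n₁ : Multiset Seg) : Prop :=
  startsSorted n₁' ≠ startsSorted n₁ ∧
    List.Forall₂ (· ≤ ·) (startsSorted n₁) (startsSorted n₁')

/-- `n₁ ⊆ m⟨k-1⟩` and `n₂ ⊆ m⟨k⟩` are minimally linked in `m`. -/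
def MinLinked (m : Multiset Seg) (k : ℤ) (n₁ n₂ : Multiset Seg) : Prop :=
  n₁ ≤ endAt m (k - 1) ∧ n₂ ≤ endAt m k ∧ LinkedByMapping n₁ n₂ ∧
    (∀ n₁' ≤ endAt m (k - 1), LinkedByMapping n₁' n₂ → n₁'.card ≤ n₁.card) ∧
    (∀ n₁' ≤ endAt m (k - 1), n₁'.card = n₁.card → MSLtStarts n₁' n₁ →
      ¬LinkedByMapping n₁' n₂)

/-- The non-free sections of a row of an upward-sequence decomposition. -/
def nfRow : List Seg → Multiset Seg
  | [] => 0
  | [_] => 0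
  | Δ :: Δ' :: rest => pushSeg (nfRow (Δ' :: rest)) (Δ'.1 - 1) Δ.2

/-- `𝔡(m)`, the sum of all non-free sections. -/
def frakd (m : Multiset Seg) : Multiset Seg :=
  (usDecomp m.card m).foldl (fun acc row => acc + nfRow row) 0

def DrhoPow (t : ℤ) : ℕ → Multiset Seg → Option (Multiset Seg)
  | 0, m => some m
  | k + 1, m => (Drho t m).bind (DrhoPow t k)

/-- `(𝒟_{[a+n-1]})^{ε_{a+n-1}} ∘ ⋯ ∘ (𝒟_{[a]})^{ε_a}(m)` where at each stage `t`
the exponent is `ε_t = ε_{[t]}` of the current multisegment; `none` codes that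
some derivative in the composition is `∞`. -/
def hdComp : ℕ → ℤ → Multiset Seg → Option (Multiset Seg)
  | 0, _, m => some m
  | k + 1, t, m =>
    match DrhoPow t (epsA t m) m with
    | none => none
    | some m' => hdComp k (t + 1) m'


/-- Pending-queue walk: `e` are closing brackets, `c` opening brackets. -/
def Qw (e c : ℕ → ℕ) : ℕ → ℕ
  | 0 => 0
  | t + 1 => (Qw e c t - e t) + c t

/-- Unmatched closing brackets. -/
def uu (e c : ℕ → ℕ) (t : ℕ) : ℕ := e t - Qw e c t

def dl (d t : ℕ) : ℕ := if t = d then 1 else 0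

def IsLast (u : ℕ → ℕ) (x y : ℕ) : Prop := 0 < u y ∧ y ≤ x ∧ ∀ t, y < t → t ≤ x → u t = 0

/-- The merged column. -/
def ff (c0 c1 : ℕ → ℕ) (t : ℕ) : ℕ := uu c0 c1 t + c1 t

lemma dl_self (d : ℕ) : dl d d = 1 := by simp [dl]
lemma dl_ne {d t : ℕ} (h : t ≠ d) : dl d t = 0 := by simp [dl, h]

lemma Qw_congr {e c e' c' : ℕ → ℕ} : ∀ t, (∀ s < t, e s = e' s ∧ c s = c' s) →
    Qw e c t = Qw e' c' t
  | 0, _ => rfl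
  | t + 1, h => by
    have ih := Qw_congr t (fun s hs => h s (by omega))
    have := h t (by omega)
    simp only [Qw]; omega

lemma Qw_ff_le (c0 c1 c2 : ℕ → ℕ) : ∀ t, Qw (ff c0 c1) c2 t ≤ Qw c1 c2 t
  | 0 => le_rfl
  | t + 1 => by
    have ih := Qw_ff_le c0 c1 c2 t
    simp only [Qw, ff]; omega

lemma exists_last (u : ℕ → ℕ) : ∀ x, (∃ y, IsLast u x y) ∨ ∀ t ≤ x, u t = 0 := by
  intro x
  induction x with
  | zero =>
    by_cases h : u 0 = 0
    · right; intro t ht; have : t = 0 := by omega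
      rw [this, h]
    · left; exact ⟨0, by omega, le_rfl, fun t h1 h2 => by omega⟩
  | succ x ih =>
    by_cases h : u (x + 1) = 0
    · rcases ih with ⟨y, h1, h2, h3⟩ | ih
      · left; refine ⟨y, h1, by omega, fun t h4 h5 => ?_⟩
        rcases Nat.lt_or_ge t (x + 1) with h6 | h6
        · exact h3 t h4 (by omega)
        · have : t = x + 1 := by omega
          rw [this, h]
      · right; intro t ht
        rcases Nat.lt_or_ge t (x + 1) with h6 | h6
        · exact ih t (by omega)
        · have : t = x + 1 := by omega
          rw [this, h]
    · left; exact ⟨x + 1, by omega, le_rfl, fun t h1 h2 => by omega⟩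

lemma IsLast.unique {u : ℕ → ℕ} {x y z : ℕ} (h : IsLast u x y) (h' : IsLast u x z) : y = z := by
  obtain ⟨h1, h2, h3⟩ := h
  obtain ⟨k1, k2, k3⟩ := h'
  rcases lt_trichotomy y z with h | h | h
  · have := h3 z h k2; omega
  · exact h
  · have := k3 y h h2; omega

lemma Dbefore {K d : ℕ} {c0 c1 c2 c1' c2' : ℕ → ℕ}
    (h1 : ∀ t, c1' t + dl d t = c1 t)
    (h2 : ∀ t, t < K → c2' t = c2 t + dl d t) : ∀ t, t ≤ d → t ≤ K → Qw c0 c1' t = Qw c0 c1 t ∧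
    Qw (ff c0 c1') c2' t = Qw (ff c0 c1) c2 t := by
  intro t
  induction t with
  | zero => intros; simp [Qw]
  | succ t ih =>
    intro ht hK
    obtain ⟨a1, a2⟩ := ih (by omega) (by omega)
    have e1 := h1 t
    have e2 := h2 t (by omega)
    rw [dl_ne (by omega)] at e1 e2
    simp only [Qw, ff, uu, a1, a2]
    omega

lemma Dafter {K d : ℕ} {c0 c1 c2 c1' c2' : ℕ → ℕ}
    (hd : 0 < uu c1 c2 d)
    (hd0 : ∀ t, d < t → uu c1 c2 t = 0)
    (h1 : ∀ t, c1' t + dl d t = c1 t)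
    (h2 : ∀ t, t < K → c2' t = c2 t + dl d t) : ∀ t, d + 1 ≤ t → t ≤ K →
    ((Qw c0 c1 t = Qw c0 c1' t + 1 ∧ Qw (ff c0 c1') c2' t = Qw (ff c0 c1) c2 t + 1 ∧
      Qw (ff c0 c1) c2 t = Qw c1 c2 t ∧ ∀ s, d < s → s < t → uu c0 c1 s = 0 ∧ uu c0 c1' s = 0) ∨
     (Qw c0 c1' t = Qw c0 c1 t ∧ Qw (ff c0 c1') c2' t = Qw (ff c0 c1) c2 t ∧
      ∃ k, d < k ∧ k < t ∧ ∀ s, d < s → s < t → uu c0 c1' s = uu c0 c1 s + dl k s ∧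
        (s < k → uu c0 c1 s = 0))) := by
  intro t ht
  induction t, ht using Nat.le_induction with
  | base =>
    intro hK
    left
    obtain ⟨a1, a2⟩ := Dbefore (c0 := c0) h1 h2 d le_rfl (by omega)
    have e1 := h1 d
    have e2 := h2 d (by omega)
    rw [dl_self] at e1 e2
    have hle := Qw_ff_le c0 c1 c2 d
    simp only [uu] at hd
    refine ⟨?_, ?_, ?_, fun s _ _ => by omega⟩
    · simp only [Qw, a1]
      omega
    · simp only [Qw, ff, uu, a1, a2]; omega
    · simp only [Qw, ff, uu]; omega
  | succ t ht ih =>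
    intro hK
    have e1 := h1 t
    have e2 := h2 t (by omega)
    rw [dl_ne (by omega)] at e1 e2
    have z := hd0 t (by omega)
    simp only [uu] at z
    rcases ih (by omega) with ⟨b1, b2, b3, b4⟩ | ⟨b1, b2, k, k1, k2, b3⟩
    · by_cases hc : c0 t < Qw c0 c1 t
      · left
        refine ⟨by simp only [Qw]; omega, by simp only [Qw, ff, uu]; omega,
          by simp only [Qw, ff, uu]; omega, fun s hs hs' => ?_⟩
        rcases Nat.lt_or_ge s t with h | h
        · exact b4 s hs h
        · have : s = t := by omega
          subst this
          simp only [uu]; omega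
      · right
        refine ⟨by simp only [Qw]; omega, by simp only [Qw, ff, uu]; omega, t, by omega, by omega,
          fun s hs hs' => ?_⟩
        rcases Nat.lt_or_ge s t with h | h
        · have := b4 s hs h
          rw [dl_ne (by omega)]; omega
        · have : s = t := by omega
          subst this
          rw [dl_self]
          simp only [uu]; omega
    · right
      refine ⟨by simp only [Qw]; omega, by simp only [Qw, ff, uu, b1, b2]; omega, k, k1, by omega,
          fun s hs hs' => ?_⟩
      rcases Nat.lt_or_ge s t with h | h
      · exact b3 s hs h
      · have : s = t := by omega
        subst this
        rw [dl_ne (by omega)]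
        simp only [uu]; omega

lemma Dq_eq {d : ℕ} {c0 c1 c2 : ℕ → ℕ}
    (hd : 0 < uu c1 c2 d) : ∀ t, d + 1 ≤ t → (∀ s, d < s → uu c1 c2 s = 0) →
    (∀ s, d < s → s < t → uu c0 c1 s = 0) →
    Qw (ff c0 c1) c2 t = Qw c1 c2 t := by
  intro t ht
  induction t, ht using Nat.le_induction with
  | base =>
    intro _ _
    have hle := Qw_ff_le c0 c1 c2 d
    simp only [uu] at hd
    simp only [Qw, ff, uu]; omega
  | succ t ht ih =>
    intro hn hs
    have := ih hn (fun s a b => hs s a (by omega))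
    have a := hs t (by omega) (by omega)
    simp only [Qw, ff, a, this]; omega

lemma DB {d : ℕ} {c0 c1 c2 : ℕ → ℕ}
    (hd : 0 < uu c1 c2 d)
    (hd0 : ∀ t, d < t → uu c1 c2 t = 0) {y : ℕ} (hy : d < y) (hu : 0 < uu (ff c0 c1) c2 y) : ∃ t, d < t ∧ t ≤ y ∧ 0 < uu c0 c1 t := by
  by_contra hcon
  push Not at hcon
  have h := Dq_eq (c0 := c0) hd y (by omega) hd0 (fun s a b => by have := hcon s a (by omega); omega)
  have a := hcon y hy le_rfl
  have z := hd0 y hy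
  simp only [uu] at z
  rw [uu, h, ff] at hu
  omega

lemma D_u1_le {K d : ℕ} {c0 c1 c2 c1' c2' : ℕ → ℕ}
    (h1 : ∀ t, c1' t + dl d t = c1 t)
    (h2 : ∀ t, t < K → c2' t = c2 t + dl d t) {t : ℕ} (ht : t ≤ d) (hK : t ≤ K) : uu c0 c1' t = uu c0 c1 t := by
  simp only [uu, (Dbefore (c0 := c0) h1 h2 t ht hK).1]

lemma D_u2_lt {K d : ℕ} {c0 c1 c2 c1' c2' : ℕ → ℕ}
    (h1 : ∀ t, c1' t + dl d t = c1 t)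
    (h2 : ∀ t, t < K → c2' t = c2 t + dl d t) {t : ℕ} (ht : t < d) (hK : t ≤ K) :
    uu (ff c0 c1') c2' t = uu (ff c0 c1) c2 t := by
  have e1 := h1 t
  rw [dl_ne (by omega)] at e1
  have := D_u1_le (c0 := c0) h1 h2 (show t ≤ d by omega) hK
  have b := (Dbefore (c0 := c0) h1 h2 t (by omega) hK).2
  rw [uu, uu, b, ff, ff, this]
  omega

lemma D_u2_d {K d : ℕ} {c0 c1 c2 c1' c2' : ℕ → ℕ}
    (hd : 0 < uu c1 c2 d)
    (h1 : ∀ t, c1' t + dl d t = c1 t)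
    (h2 : ∀ t, t < K → c2' t = c2 t + dl d t) (hK : d ≤ K) :
    uu (ff c0 c1') c2' d + 1 = uu (ff c0 c1) c2 d := by
  have e1 := h1 d
  rw [dl_self] at e1
  have := D_u1_le (c0 := c0) h1 h2 (show d ≤ d by omega) hK
  have b := (Dbefore (c0 := c0) h1 h2 d (by omega) hK).2
  have hle := Qw_ff_le c0 c1 c2 d
  rw [uu, uu, b, ff, ff, this]
  rw [uu] at hd
  omega

lemma D_u2_gt {K d : ℕ} {c0 c1 c2 c1' c2' : ℕ → ℕ}
    (hd : 0 < uu c1 c2 d)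
    (hd0 : ∀ t, d < t → uu c1 c2 t = 0)
    (h1 : ∀ t, c1' t + dl d t = c1 t)
    (h2 : ∀ t, t < K → c2' t = c2 t + dl d t) {t : ℕ} (ht : d < t) (hK : t ≤ K) :
    uu (ff c0 c1') c2' t = uu (ff c0 c1) c2 t := by
  have e1 := h1 t
  rw [dl_ne (by omega)] at e1
  have z := hd0 t (by omega)
  rw [uu] at z
  rcases Dafter (c0 := c0) hd hd0 h1 h2 t ht hK with ⟨b1, b2, b3, b4⟩ | ⟨b1, b2, k, k1, k2, b3⟩
  · rw [uu, uu, b2, ff, ff, uu, uu]; omega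
  · rw [uu, uu, b2, ff, ff, uu, uu, b1]; omega

lemma D_u1_gt {K d : ℕ} {c0 c1 c2 c1' c2' : ℕ → ℕ}
    (hd : 0 < uu c1 c2 d)
    (hd0 : ∀ t, d < t → uu c1 c2 t = 0)
    (h1 : ∀ t, c1' t + dl d t = c1 t)
    (h2 : ∀ t, t < K → c2' t = c2 t + dl d t) : ∃ k, d < k ∧ ∀ s, d < s → s ≤ K → uu c0 c1' s = uu c0 c1 s + dl k s ∧
        (s < k → uu c0 c1 s = 0) := by
  rcases Nat.lt_or_ge d K with hK | hK
  swap
  · exact ⟨d + 1, by omega, fun s a b => by omega⟩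
  rcases Dafter (c0 := c0) hd hd0 h1 h2 K hK le_rfl with ⟨b1, b2, b3, b4⟩ | ⟨b1, b2, k, k1, k2, b3⟩
  · by_cases hc : c0 K < Qw c0 c1 K
    · refine ⟨K + 1, by omega, fun s a b => ?_⟩
      rw [dl_ne (by omega)]
      rcases Nat.lt_or_ge s K with h | h
      · have := b4 s a h; omega
      · have : s = K := by omega
        subst this
        rw [uu, uu]; omega
    · refine ⟨K, by omega, fun s a b => ?_⟩
      rcases Nat.lt_or_ge s K with h | h
      · have := b4 s a h
        rw [dl_ne (by omega)]; omega
      · have : s = K := by omega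
        subst this
        rw [uu, uu, dl_self]; omega
  · refine ⟨k, k1, fun s a b => ?_⟩
    rcases Nat.lt_or_ge s K with h | h
    · exact b3 s a h
    · have : s = K := by omega
      subst this
      rw [uu, uu, dl_ne (by omega)]; omega

/-- The merged third column is unchanged. -/
lemma D_g {K d : ℕ} {c0 c1 c2 c1' c2' : ℕ → ℕ}
    (hd : 0 < uu c1 c2 d)
    (hd0 : ∀ t, d < t → uu c1 c2 t = 0)
    (h1 : ∀ t, c1' t + dl d t = c1 t)
    (h2 : ∀ t, t < K → c2' t = c2 t + dl d t) {t : ℕ} (hK : t < K) :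
    uu (ff c0 c1') c2' t + c2' t = uu (ff c0 c1) c2 t + c2 t := by
  have e2 := h2 t hK
  rcases lt_trichotomy t d with h | h | h
  · rw [dl_ne (by omega)] at e2
    rw [D_u2_lt h1 h2 h (by omega)]; omega
  · subst h
    rw [dl_self] at e2
    have := D_u2_d (c0 := c0) hd h1 h2 (by omega)
    omega
  · rw [dl_ne (by omega)] at e2
    rw [D_u2_gt hd hd0 h1 h2 h (by omega)]; omega

/-- Special case: backwards analysis from `d`. -/
lemma D_back (hu : uu (ff c0 c1) c2 d = 1) (hd : 0 < uu c1 c2 d) : ∀ j t, t + j = d →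
    (∀ s, t ≤ s → s < d → uu (ff c0 c1) c2 s = 0) →
    uu c0 c1 t = 0 ∧ Qw (ff c0 c1) c2 t = Qw c1 c2 t := by
  intro j
  induction j with
  | zero =>
    intro t ht _
    have : t = d := by omega
    subst this
    have hle := Qw_ff_le c0 c1 c2 t
    rw [uu, ff] at hu
    rw [uu] at hd
    constructor <;> omega
  | succ j ih =>
    intro t ht hs
    obtain ⟨a1, a2⟩ := ih (t + 1) (by omega) (fun s a b => hs s (by omega) b)
    have hz := hs t le_rfl (by omega)
    have hle := Qw_ff_le c0 c1 c2 t
    rw [uu, ff] at hz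
    simp only [Qw, ff] at a2
    constructor <;> omega


lemma C1 {K x y y' : ℕ} {c0 c1 c2 s1 s2 : ℕ → ℕ}
    (hx : x ≤ K)
    (hy : IsLast (uu (ff c0 c1) c2) x y)
    (hy' : IsLast (uu c0 c1) y y')
    (h1 : ∀ t, s1 t + dl y t = c1 t + dl y' t)
    (h2 : ∀ t, t < K → s2 t + dl x t = c2 t + dl y t) : ∀ t, t ≤ y' → Qw s1 s2 t = Qw c1 c2 t := by
  obtain ⟨_, q1, _⟩ := hy
  obtain ⟨_, q2, _⟩ := hy'
  intro t ht
  apply Qw_congr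
  intro s hs
  have e1 := h1 s
  have e2 := h2 s (by omega)
  rw [dl_ne (by omega), dl_ne (by omega)] at e1 e2
  omega

lemma C2 {K x y y' : ℕ} {c0 c1 c2 s1 s2 : ℕ → ℕ}
    (hx : x ≤ K)
    (hy : IsLast (uu (ff c0 c1) c2) x y)
    (hy' : IsLast (uu c0 c1) y y')
    (h1 : ∀ t, s1 t + dl y t = c1 t + dl y' t)
    (h2 : ∀ t, t < K → s2 t + dl x t = c2 t + dl y t) : ∀ t, y' + 1 ≤ t → t ≤ y → Qw (ff c0 c1) c2 t ≤ Qw s1 s2 t ∧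
    ((Qw s1 s2 t + 1 = Qw c1 c2 t ∧ ∀ s, y' ≤ s → s < t → s1 s ≤ Qw s1 s2 s) ∨
     (Qw s1 s2 t = Qw c1 c2 t ∧ Qw (ff c0 c1) c2 t = Qw c1 c2 t)) := by
  obtain ⟨_, q1, _⟩ := id hy
  obtain ⟨r0, q2, r1⟩ := id hy'
  intro t ht
  induction t, ht using Nat.le_induction with
  | base =>
    intro hty
    have c := C1 hx hy hy' h1 h2 y' le_rfl
    have e1 := h1 y'
    have e2 := h2 y' (by omega)
    rw [dl_ne (by omega), dl_self] at e1
    rw [dl_ne (by omega), dl_ne (by omega)] at e2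
    have hle := Qw_ff_le c0 c1 c2 y'
    have f := ff.eq_1 c0 c1 y'
    simp only [Qw, c]
    refine ⟨by omega, ?_⟩
    by_cases hp : c1 y' + 1 ≤ Qw c1 c2 y'
    · left
      refine ⟨by omega, fun s a b => ?_⟩
      have : s = y' := by omega
      subst this
      omega
    · right; omega
  | succ t ht ih =>
    intro hty
    have e1 := h1 t
    have e2 := h2 t (by omega)
    rw [dl_ne (by omega), dl_ne (by omega)] at e1 e2
    have hle := Qw_ff_le c0 c1 c2 t
    have f := ff.eq_1 c0 c1 t
    have z := r1 t (by omega) (by omega)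
    obtain ⟨i0, ⟨i1, i2⟩ | ⟨i1, i2⟩⟩ := ih (by omega)
    · simp only [Qw]
      refine ⟨by omega, ?_⟩
      by_cases hp : c1 t ≤ Qw s1 s2 t
      · left
        refine ⟨by omega, fun s a b => ?_⟩
        rcases Nat.lt_or_ge s t with h | h
        · exact i2 s a h
        · have : s = t := by omega
          subst this
          omega
      · right; omega
    · simp only [Qw]
      refine ⟨by omega, Or.inr (by omega)⟩

lemma C3 {K x y y' : ℕ} {c0 c1 c2 s1 s2 : ℕ → ℕ}
    (hx : x ≤ K)
    (hy : IsLast (uu (ff c0 c1) c2) x y)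
    (hy' : IsLast (uu c0 c1) y y')
    (h1 : ∀ t, s1 t + dl y t = c1 t + dl y' t)
    (h2 : ∀ t, t < K → s2 t + dl x t = c2 t + dl y t) : ∀ t, y + 1 ≤ t → t ≤ x → Qw s1 s2 t = Qw c1 c2 t + 1 := by
  obtain ⟨p0, q1, p1⟩ := id hy
  obtain ⟨r0, q2, r1⟩ := id hy'
  intro t ht
  induction t, ht using Nat.le_induction with
  | base =>
    intro hty
    have e1 := h1 y
    have e2 := h2 y (by omega)
    have f := ff.eq_1 c0 c1 y
    rw [uu] at p0
    rw [dl_ne (by omega), dl_self] at e2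
    rw [dl_self] at e1
    rcases Nat.lt_or_ge y' y with h | h
    · rw [dl_ne (by omega)] at e1
      have z := r1 y (by omega) (by omega)
      obtain ⟨i0, ⟨i1, i2⟩ | ⟨i1, i2⟩⟩ := C2 hx hy hy' h1 h2 y h le_rfl <;> (simp only [Qw]; omega)
    · have : y' = y := by omega
      subst this
      have c := C1 hx hy hy' h1 h2 y' le_rfl
      rw [dl_self] at e1
      simp only [Qw]; omega
  | succ t ht ih =>
    intro htx
    have e1 := h1 t
    have e2 := h2 t (by omega)
    rw [dl_ne (by omega), dl_ne (by omega)] at e1 e2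
    have i := ih (by omega)
    have z := p1 t (by omega) (by omega)
    have hle := Qw_ff_le c0 c1 c2 t
    have f := ff.eq_1 c0 c1 t
    rw [uu] at z
    simp only [Qw]; omega

lemma C4 {K x y y' : ℕ} {c0 c1 c2 s1 s2 : ℕ → ℕ}
    (hx : x ≤ K)
    (hy : IsLast (uu (ff c0 c1) c2) x y)
    (hy' : IsLast (uu c0 c1) y y')
    (h1 : ∀ t, s1 t + dl y t = c1 t + dl y' t)
    (h2 : ∀ t, t < K → s2 t + dl x t = c2 t + dl y t) : ∀ t, x + 1 ≤ t → t ≤ K → Qw s1 s2 t = Qw c1 c2 t := by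
  obtain ⟨p0, q1, p1⟩ := id hy
  obtain ⟨r0, q2, r1⟩ := id hy'
  intro t ht
  induction t, ht using Nat.le_induction with
  | base =>
    intro hxK
    have e1 := h1 x
    have e2 := h2 x (by omega)
    have f := ff.eq_1 c0 c1 x
    rw [dl_self] at e2
    rcases Nat.lt_or_ge y x with h | h
    · have c := C3 hx hy hy' h1 h2 x h le_rfl
      rw [dl_ne (by omega)] at e2
      rw [dl_ne (by omega), dl_ne (by omega)] at e1
      have z := p1 x (by omega) (by omega)
      have hle := Qw_ff_le c0 c1 c2 x
      rw [uu] at z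
      simp only [Qw]; omega
    · have : y = x := by omega
      subst this
      rw [dl_self] at e2 e1
      rw [uu] at p0
      rcases Nat.lt_or_ge y' y with h | h
      · rw [dl_ne (by omega)] at e1
        have z := r1 y (by omega) (by omega)
        obtain ⟨i0, ⟨i1, i2⟩ | ⟨i1, i2⟩⟩ := C2 hx hy hy' h1 h2 y h le_rfl <;> (simp only [Qw]; omega)
      · have : y' = y := by omega
        subst this
        have c := C1 hx hy hy' h1 h2 y' le_rfl
        rw [dl_self] at e1
        simp only [Qw]; omega
  | succ t ht ih =>
    intro htx
    have e1 := h1 t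
    have e2 := h2 t (by omega)
    rw [dl_ne (by omega), dl_ne (by omega)] at e1 e2
    have i := ih (by omega)
    simp only [Qw]; omega

/-- unmatched after `y` is unchanged -/
lemma C5 {K x y y' : ℕ} {c0 c1 c2 s1 s2 : ℕ → ℕ}
    (hx : x ≤ K)
    (hy : IsLast (uu (ff c0 c1) c2) x y)
    (hy' : IsLast (uu c0 c1) y y')
    (h1 : ∀ t, s1 t + dl y t = c1 t + dl y' t)
    (h2 : ∀ t, t < K → s2 t + dl x t = c2 t + dl y t) (hK : ∀ t, K < t → c1 t = 0) {t : ℕ} (ht : y < t) : uu s1 s2 t = uu c1 c2 t := by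
  obtain ⟨p0, q1, p1⟩ := id hy
  obtain ⟨r0, q2, r1⟩ := id hy'
  have e1 := h1 t
  rw [dl_ne (by omega), dl_ne (by omega)] at e1
  rcases Nat.lt_or_ge K t with h | h
  · have := hK t h
    simp only [uu]; omega
  rcases Nat.lt_or_ge x t with h' | h'
  · have := C4 hx hy hy' h1 h2 t h' h
    simp only [uu]; omega
  · have c := C3 hx hy hy' h1 h2 t ht h'
    have z := p1 t (by omega) (by omega)
    have hle := Qw_ff_le c0 c1 c2 t
    have f := ff.eq_1 c0 c1 t
    rw [uu] at z
    simp only [uu]; omega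


/-- Main local theorem: the operations commute. -/
theorem loc1 {K d x y y' : ℕ} {c0 c1 c2 c1' c2' s1 s2 : ℕ → ℕ}
    (hK : ∀ t, K < t → c1 t = 0) (hx : x ≤ K)
    (hd : 0 < uu c1 c2 d) (hd0 : ∀ t, d < t → uu c1 c2 t = 0)
    (h1 : ∀ t, c1' t + dl d t = c1 t) (h2 : ∀ t, t < K → c2' t = c2 t + dl d t)
    (hy : IsLast (uu (ff c0 c1) c2) x y) (hy' : IsLast (uu c0 c1) y y')
    (k1 : ∀ t, s1 t + dl y t = c1 t + dl y' t)
    (k2 : ∀ t, t < K → s2 t + dl x t = c2 t + dl y t) :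
    ∃ yy d', IsLast (uu (ff c0 c1') c2') x yy ∧ IsLast (uu c0 c1') yy y' ∧
      0 < uu s1 s2 d' ∧ (∀ t, d' < t → uu s1 s2 t = 0) ∧
      ((yy = y ∧ d' = d) ∨ (y = d ∧ d' = yy)) := by
  obtain ⟨p0, q1, p1⟩ := id hy
  obtain ⟨r0, q2, r1⟩ := id hy'
  have hdK : d ≤ K := by
    by_contra h
    have := hK d (by omega)
    rw [uu] at hd; omega
  have hu2d := D_u2_d (c0 := c0) hd h1 h2 hdK
  rcases eq_or_ne y d with hyd | hyd
  · subst hyd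
    -- special case
    have hu2le : ∀ t, t ≠ y → t ≤ K → uu (ff c0 c1') c2' t = uu (ff c0 c1) c2 t := by
      intro t h3 h4
      rcases Nat.lt_or_ge t y with h | h
      · exact D_u2_lt h1 h2 h h4
      · exact D_u2_gt hd hd0 h1 h2 (by omega) h4
    rcases exists_last (uu (ff c0 c1') c2') y with ⟨yy, y0, y1, y2⟩ | hno
    swap
    · exfalso
      have u1 : uu (ff c0 c1) c2 y = 1 := by have := hno y le_rfl; omega
      have := (D_back u1 hd (y - y') y' (by omega)
        (fun s a b => by rw [← hu2le s (by omega) (by omega)]; exact hno s (by omega))).1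
      omega
    have hyy : IsLast (uu (ff c0 c1') c2') x yy := by
      refine ⟨y0, by omega, fun t a b => ?_⟩
      rcases Nat.lt_or_ge y t with h | h
      · rw [hu2le t (by omega) (by omega)]; exact p1 t h b
      · exact y2 t a h
    rcases Nat.lt_or_ge yy y with hlt | hge
    · have u1 : uu (ff c0 c1) c2 y = 1 := by have := y2 y hlt le_rfl; omega
      have back : ∀ t, yy < t → t ≤ y → uu c0 c1 t = 0 ∧ Qw (ff c0 c1) c2 t = Qw c1 c2 t := by
        intro t a b
        exact D_back u1 hd (y - t) t (by omega)
          (fun s a' b => by rw [← hu2le s (by omega) (by omega)]; exact y2 s (by omega) (by omega))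
      have hy'yy : y' ≤ yy := by
        by_contra h
        have := (back y' (by omega) q2).1
        omega
      have hu1yy : uu (ff c0 c1) c2 yy = uu (ff c0 c1') c2' yy := (hu2le yy (by omega) (by omega)).symm
      rw [← hu1yy, uu] at y0
      have fyy := ff.eq_1 c0 c1 yy
      have bb := (back (yy + 1) (by omega) (by omega)).2
      simp only [Qw] at bb
      have hpc : Qw c1 c2 yy ≤ c1 yy := by omega
      have eyy := k1 yy
      rw [dl_ne (by omega)] at eyy
      have eyy2 := k2 yy (by omega)
      rw [dl_ne (by omega), dl_ne (by omega)] at eyy2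
      have key : 0 < uu s1 s2 yy ∧ Qw s1 s2 (yy + 1) = Qw c1 c2 (yy + 1) := by
        rcases Nat.lt_or_ge y' yy with h | h
        · rw [dl_ne (by omega)] at eyy
          have z := r1 yy h (by omega)
          obtain ⟨i0, ⟨i1, i2⟩ | ⟨i1, i2⟩⟩ := C2 hx hy hy' k1 k2 yy h (by omega) <;>
          (simp only [Qw, uu]; omega)
        · have : y' = yy := by omega
          subst this
          rw [dl_self] at eyy
          have c := C1 hx hy hy' k1 k2 y' le_rfl
          simp only [Qw, uu]; omega
      have peq : ∀ t, yy + 1 ≤ t → t ≤ y → Qw s1 s2 t = Qw c1 c2 t := by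
        intro t ht
        induction t, ht using Nat.le_induction with
        | base => intro _; exact key.2
        | succ t ht ih =>
          intro hh
          have e1 := k1 t
          have e2 := k2 t (by omega)
          rw [dl_ne (by omega), dl_ne (by omega)] at e1 e2
          have i := ih (by omega)
          simp only [Qw]; omega
      refine ⟨yy, yy, hyy, ⟨?_, hy'yy, ?_⟩, key.1, ?_, Or.inr ⟨rfl, rfl⟩⟩
      · rw [D_u1_le h1 h2 (by omega) (by omega)]; exact r0
      · intro t a b
        rw [D_u1_le h1 h2 (by omega) (by omega)]; exact r1 t a (by omega)
      · intro t ht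
        rcases Nat.lt_or_ge y t with h | h
        · rw [C5 hx hy hy' k1 k2 hK h]; exact hd0 t h
        · have e1 := k1 t
          have pe := peq t ht h
          have bk := back t ht h
          have f := ff.eq_1 c0 c1 t
          rw [dl_ne (show t ≠ y' by omega)] at e1
          rcases Nat.lt_or_ge t y with h' | h'
          · rw [dl_ne (by omega)] at e1
            have z := y2 t ht h
            rw [hu2le t (by omega) (by omega), uu] at z
            simp only [uu]; omega
          · have : t = y := by omega
            subst this
            rw [dl_self] at e1
            rw [uu] at u1
            simp only [uu]; omega
    · have hyy' : yy = y := by omega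
      subst hyy'
      refine ⟨yy, yy, hyy, ⟨?_, q2, ?_⟩, ?_, ?_, Or.inr ⟨rfl, rfl⟩⟩
      · rw [D_u1_le h1 h2 (by omega) (by omega)]; exact r0
      · intro t a b
        rw [D_u1_le h1 h2 (by omega) (by omega)]; exact r1 t a (by omega)
      · have e1 := k1 yy
        rw [dl_self] at e1
        have f := ff.eq_1 c0 c1 yy
        rw [uu] at hd
        have hq := uu.eq_1 (ff c0 c1) c2 yy
        rcases Nat.lt_or_ge y' yy with h | h
        · rw [dl_ne (by omega)] at e1
          have z := r1 yy h (by omega)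
          obtain ⟨i0, ⟨i1, i2⟩ | ⟨i1, i2⟩⟩ := C2 hx hy hy' k1 k2 yy h (by omega) <;>
          (simp only [uu]; omega)
        · have : y' = yy := by omega
          subst this
          rw [dl_self] at e1
          have c := C1 hx hy hy' k1 k2 y' le_rfl
          simp only [uu]; omega
      · intro t ht
        rw [C5 hx hy hy' k1 k2 hK ht]; exact hd0 t ht
  · -- generic case
    have hu2 : ∀ t, t ≠ d → t ≤ K → uu (ff c0 c1') c2' t = uu (ff c0 c1) c2 t := by
      intro t h3 h4
      rcases Nat.lt_or_ge t d with h | h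
      · exact D_u2_lt h1 h2 h h4
      · exact D_u2_gt hd hd0 h1 h2 (by omega) h4
    have hyy : IsLast (uu (ff c0 c1') c2') x y := by
      refine ⟨by rw [hu2 y hyd (by omega)]; exact p0, by omega, fun t a b => ?_⟩
      have := p1 t a b
      have htd : t ≠ d := by rintro rfl; omega
      rw [hu2 t htd (by omega)]; exact this
    have hdcase : d < y' ∨ y < d := by
      rcases Nat.lt_or_ge y d with h | h
      · exact Or.inr h
      · left
        obtain ⟨t, t1, t2, t3⟩ := DB (c0 := c0) hd hd0 (show d < y by omega) p0
        by_contra hcon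
        have := r1 t (by omega) t2
        omega
    have hyy' : IsLast (uu c0 c1') y y' := by
      rcases hdcase with h | h
      · obtain ⟨k, kd, hk⟩ := D_u1_gt (c0 := c0) hd hd0 h1 h2
        have hky : k ≤ y' := by
          by_contra hc
          have := (hk y' h (by omega)).2 (by omega)
          omega
        refine ⟨by rw [(hk y' h (by omega)).1]; omega, q2, fun t a b => ?_⟩
        rw [(hk t (by omega) (by omega)).1, dl_ne (by omega), r1 t a b]
      · refine ⟨by rw [D_u1_le h1 h2 (by omega) (by omega)]; exact r0, q2, fun t a b => ?_⟩
        rw [D_u1_le h1 h2 (by omega) (by omega)]; exact r1 t a b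
    refine ⟨y, d, hyy, hyy', ?_, ?_, Or.inl ⟨rfl, rfl⟩⟩
    · rcases hdcase with h | h
      · have c := C1 hx hy hy' k1 k2 d (by omega)
        have e1 := k1 d
        rw [dl_ne (by omega), dl_ne (by omega)] at e1
        rw [uu] at hd ⊢; omega
      · rw [C5 hx hy hy' k1 k2 hK h]; exact hd
    · intro t ht
      rcases Nat.lt_or_ge y t with h | h
      · rw [C5 hx hy hy' k1 k2 hK h]; exact hd0 t ht
      have hdy' : d < y' := by omega
      have z := hd0 t ht
      have e1 := k1 t
      rcases Nat.lt_or_ge t y' with h3 | h3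
      · have c := C1 hx hy hy' k1 k2 t (by omega)
        rw [dl_ne (by omega), dl_ne (by omega)] at e1
        rw [uu] at z ⊢; omega
      · rcases Nat.lt_or_ge y' y with h4 | h4
        · have zy := hd0 y (by omega)
          have ey := k1 y
          rw [dl_self, dl_ne (by omega)] at ey
          have f := ff.eq_1 c0 c1 y
          have u1y := r1 y h4 le_rfl
          obtain ⟨i0, ⟨i1, i2⟩ | ⟨i1, i2⟩⟩ := C2 hx hy hy' k1 k2 y h4 le_rfl
          · rcases Nat.lt_or_ge t y with h5 | h5
            · have := i2 t h3 h5
              rw [uu]; omega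
            · have : t = y := by omega
              subst this
              rw [uu] at z ⊢; omega
          · exfalso
            rw [uu] at p0 zy
            omega
        · have ty : t = y := by omega
          have yy : y' = y := by omega
          subst ty
          subst yy
          have c := C1 hx hy hy' k1 k2 y' le_rfl
          rw [uu] at z ⊢; omega

/-- Converse existence. -/
theorem loc2 {K d x yy y' : ℕ} {c0 c1 c2 c1' c2' : ℕ → ℕ}
    (hK : ∀ t, K < t → c1 t = 0) (hx : x ≤ K)
    (hd : 0 < uu c1 c2 d) (hd0 : ∀ t, d < t → uu c1 c2 t = 0)
    (h1 : ∀ t, c1' t + dl d t = c1 t) (h2 : ∀ t, t < K → c2' t = c2 t + dl d t)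
    (hy : IsLast (uu (ff c0 c1') c2') x yy) (hy' : IsLast (uu c0 c1') yy y') :
    ∃ y z, IsLast (uu (ff c0 c1) c2) x y ∧ IsLast (uu c0 c1) y z := by
  obtain ⟨p0, q1, p1⟩ := id hy
  obtain ⟨r0, q2, r1⟩ := id hy'
  have hdK : d ≤ K := by
    by_contra h
    have := hK d (by omega)
    rw [uu] at hd; omega
  have hu2d := D_u2_d (c0 := c0) hd h1 h2 hdK
  have hu2 : ∀ t, t ≠ d → t ≤ K → uu (ff c0 c1') c2' t = uu (ff c0 c1) c2 t := by
    intro t h3 h4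
    rcases Nat.lt_or_ge t d with h | h
    · exact D_u2_lt h1 h2 h h4
    · exact D_u2_gt hd hd0 h1 h2 (by omega) h4
  have hpos : 0 < uu (ff c0 c1) c2 yy := by
    rcases eq_or_ne yy d with h | h
    · rw [h]; omega
    · rw [← hu2 yy h (by omega)]; exact p0
  obtain ⟨y, hy1⟩ : ∃ y, IsLast (uu (ff c0 c1) c2) x y := by
    rcases exists_last (uu (ff c0 c1) c2) x with h | h
    · exact h
    · have := h yy q1; omega
  obtain ⟨b0, b1, b2⟩ := id hy1
  have hyyy : yy ≤ y := by
    by_contra h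
    have := b2 yy (by omega) q1
    omega
  refine ⟨y, ?_⟩
  rcases exists_last (uu c0 c1) y with ⟨z, h⟩ | h
  · exact ⟨z, hy1, h⟩
  exfalso
  rcases Nat.lt_or_ge d y with h3 | h3
  · obtain ⟨t, t1, t2, t3⟩ := DB (c0 := c0) hd hd0 h3 b0
    have := h t t2; omega
  · rw [D_u1_le h1 h2 (by omega) (by omega)] at r0
    have := h y' (by omega); omega

def Nx (n : Multiset Seg) (p q : Seg) : Prop :=
  q ∈ n ∧ Prec p q ∧ ∀ r ∈ n, Prec p r → q.1 ≤ r.1 ∧ (r.1 = q.1 → r.2 ≤ q.2)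

inductive Chain (n : Multiset Seg) : Seg → List Seg → Prop
  | nil (p : Seg) : (∀ r ∈ n, ¬ Prec p r) → Chain n p []
  | cons (p q : Seg) (l : List Seg) : Nx n p q → Chain n q l → Chain n p (q :: l)

def IsRow (n : Multiset Seg) (R : List Seg) : Prop :=
  ∃ p l, R = p :: l ∧ p ∈ n ∧ (∀ r ∈ n, p.1 ≤ r.1 ∧ (r.1 = p.1 → r.2 ≤ p.2)) ∧ Chain n p l

def Pick (R : List Seg) (T : ℤ) (D : Seg) : Prop :=
  D ∈ R ∧ D.1 ≤ T ∧ ∀ r ∈ R, r.1 ≤ T → r.1 ≤ D.1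

inductive Phi (b : ℤ) : Multiset Seg → ℤ → ℤ → Multiset Seg → Prop
  | zero : Phi b 0 (b + 1) b 0
  | step (n : Multiset Seg) (R : List Seg) (T z : ℤ) (M : Multiset Seg) (D : Seg) (z' : ℤ)
      (M' : Multiset Seg) :
      IsRow n R → Phi b (n - (R : Multiset Seg)) T z M → Pick R T D →
      z' = (if D.1 = T then z else D.2) → M' + {D} = M + (R : Multiset Seg) + {(T, D.2)} →
      Phi b n D.1 z' M'

lemma Nx.unique {n : Multiset Seg} {p q q' : Seg} (h : Nx n p q) (h' : Nx n p q') : q = q' := by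
  obtain ⟨h1, h2, h3⟩ := h
  obtain ⟨k1, k2, k3⟩ := h'
  have e1 := h3 _ k1 k2
  have e2 := k3 _ h1 h2
  have f : q.1 = q'.1 := le_antisymm e1.1 e2.1
  have g : q.2 = q'.2 := le_antisymm (e2.2 f) (e1.2 f.symm)
  exact Prod.ext f g

lemma Chain.unique {n : Multiset Seg} {p : Seg} {l l' : List Seg} (h : Chain n p l)
    (h' : Chain n p l') : l = l' := by
  induction h generalizing l' with
  | nil p h0 =>
    cases h' with
    | nil => rfl
    | cons _ q l hq _ => exact absurd hq.2.1 (h0 _ hq.1)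
  | cons p q l hq hl ih =>
    cases h' with
    | nil _ h0 => exact absurd hq.2.1 (h0 _ hq.1)
    | cons _ q' l' hq' hl' =>
      obtain rfl := hq.unique hq'
      rw [ih hl']

lemma IsRow.unique {n : Multiset Seg} {R R' : List Seg} (h : IsRow n R) (h' : IsRow n R') :
    R = R' := by
  obtain ⟨p, l, rfl, hp, hp2, hl⟩ := h
  obtain ⟨p', l', rfl, hp', hp2', hl'⟩ := h'
  have e1 := hp2 _ hp'
  have e2 := hp2' _ hp
  have f : p.1 = p'.1 := le_antisymm e1.1 e2.1
  have g : p.2 = p'.2 := le_antisymm (e2.2 f) (e1.2 f.symm)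
  obtain rfl : p = p' := Prod.ext f g
  rw [hl.unique hl']

lemma Chain.gt {n : Multiset Seg} {p : Seg} {l : List Seg} (h : Chain n p l) :
    ∀ r ∈ l, p.1 < r.1 ∧ p.2 < r.2 ∧ r ∈ n := by
  induction h with
  | nil p h0 => simp
  | cons p q l hq hl ih =>
    intro r hr
    rcases List.mem_cons.1 hr with rfl | hr
    · exact ⟨hq.2.1.1, hq.2.1.2.1, hq.1⟩
    · have := ih r hr
      have := hq.2.1.1
      have := hq.2.1.2.1
      refine ⟨by omega, by omega, by tauto⟩

lemma Chain.pw {n : Multiset Seg} {p : Seg} {l : List Seg} (h : Chain n p l) :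
    (p :: l).Pairwise (fun x y => x.1 < y.1) := by
  induction h with
  | nil p h0 => simp
  | cons p q l hq hl ih =>
    refine List.Pairwise.cons ?_ ih
    intro r hr
    rcases List.mem_cons.1 hr with rfl | hr
    · exact hq.2.1.1
    · have := hl.gt r hr
      have := hq.2.1.1
      omega

lemma IsRow.pw {n : Multiset Seg} {R : List Seg} (h : IsRow n R) :
    R.Pairwise (fun x y => x.1 < y.1) := by
  obtain ⟨p, l, rfl, hp, hp2, hl⟩ := h
  exact hl.pw

lemma IsRow.mem {n : Multiset Seg} {R : List Seg} (h : IsRow n R) : ∀ r ∈ R, r ∈ n := by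
  obtain ⟨p, l, rfl, hp, hp2, hl⟩ := h
  intro r hr
  rcases List.mem_cons.1 hr with rfl | hr
  · exact hp
  · exact (hl.gt r hr).2.2

lemma IsRow.nodup {n : Multiset Seg} {R : List Seg} (h : IsRow n R) : R.Nodup := by
  refine h.pw.imp ?_
  rintro x y hxy rfl
  omega

lemma IsRow.le {n : Multiset Seg} {R : List Seg} (h : IsRow n R) : (R : Multiset Seg) ≤ n := by
  rw [Multiset.le_iff_subset (Multiset.coe_nodup.2 h.nodup)]
  intro r hr
  exact h.mem r (by simpa using hr)

lemma IsRow.ne {n : Multiset Seg} {R : List Seg} (h : IsRow n R) : n ≠ 0 := by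
  obtain ⟨p, l, rfl, hp, hp2, hl⟩ := h
  rintro rfl
  simp at hp

lemma IsRow.card {n : Multiset Seg} {R : List Seg} (h : IsRow n R) :
    (n - (R : Multiset Seg)).card < n.card := by
  have h1 := Multiset.card_sub h.le
  have h2 := Multiset.card_le_card h.le
  obtain ⟨p, l, rfl, hp, hp2, hl⟩ := h
  simp at h1 h2
  simp [h1]
  omega

lemma Chain.congr {n n' : Multiset Seg} {p : Seg} {l : List Seg} (h : Chain n p l)
    (hc : ∀ r : Seg, p.1 < r.1 → (r ∈ n ↔ r ∈ n')) : Chain n' p l := by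
  induction h with
  | nil p h0 =>
    refine Chain.nil p fun r hr hpr => h0 r ((hc r hpr.1).2 hr) hpr
  | cons p q l hq hl ih =>
    refine Chain.cons p q l ⟨(hc q hq.2.1.1).1 hq.1, hq.2.1, fun r hr hpr =>
      hq.2.2 r ((hc r hpr.1).2 hr) hpr⟩ (ih fun r hr => hc r ?_)
    have := hq.2.1.1
    omega

lemma Pick.unique {R : List Seg} {T : ℤ} {D D' : Seg}
    (hR : R.Pairwise (fun x y => x.1 < y.1)) (h : Pick R T D) (h' : Pick R T D') : D = D' := by
  have e : D.1 = D'.1 := le_antisymm (h'.2.2 _ h.1 h.2.1) (h.2.2 _ h'.1 h'.2.1)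
  by_contra hne
  have key : ∀ (L : List Seg), L.Pairwise (fun x y => x.1 < y.1) → ∀ x ∈ L, ∀ y ∈ L,
      x.1 = y.1 → x = y := by
    intro L
    induction L with
    | nil => simp
    | cons w L ih =>
      intro hL x hx y hy hxy
      rw [List.pairwise_cons] at hL
      rcases List.mem_cons.1 hx with hx1 | hx1 <;> rcases List.mem_cons.1 hy with hy1 | hy1
      · rw [hx1, hy1]
      · have := hL.1 _ hy1; rw [hx1] at hxy; omega
      · have := hL.1 _ hx1; rw [hy1] at hxy; omega
      · exact ih hL.2 x hx1 y hy1 hxy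
  exact hne (key R hR _ h.1 _ h'.1 e)

lemma Phi.unique {b : ℤ} {n : Multiset Seg} {T z : ℤ} {M : Multiset Seg} (h : Phi b n T z M)
    {T' z' : ℤ} {M' : Multiset Seg} (h' : Phi b n T' z' M') : T = T' ∧ z = z' ∧ M = M' := by
  induction h generalizing T' z' M' with
  | zero =>
    cases h' with
    | zero => simp
    | step _ R _ _ _ _ _ _ hR => exact absurd rfl hR.ne
  | step n R T z M D z1 M1 hR hP hD hz hM ih =>
    cases h' with
    | zero => exact absurd rfl hR.ne
    | step _ R' T' z' M' D' z1' M1' hR' hP' hD' hz' hM' =>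
      obtain rfl := hR.unique hR'
      obtain ⟨rfl, rfl, rfl⟩ := ih hP'
      obtain rfl := hD.unique hR.pw hD'
      refine ⟨rfl, by rw [hz, hz'], ?_⟩
      rw [← hM'] at hM
      exact add_right_cancel hM

/-- lower bounds -/
lemma Phi.ge {b s : ℤ} {n : Multiset Seg} {T z : ℤ} {M : Multiset Seg} (h : Phi b n T z M)
    (hs : s ≤ b + 1) (hn : ∀ r ∈ n, s ≤ r.1) : s ≤ T ∧ ∀ r ∈ M, s ≤ r.1 := by
  induction h with
  | zero => simp [hs]
  | step n R T z M D z1 M1 hR hP hD hz hM ih =>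
    have ih := ih (fun r hr => hn r (Multiset.mem_of_le (Multiset.sub_le_self _ _) hr))
    refine ⟨hn _ (hR.mem _ hD.1), fun r hr => ?_⟩
    have : r ∈ M + (R : Multiset Seg) + {(T, D.2)} := by
      rw [← hM]; simp [hr]
    simp only [Multiset.mem_add, Multiset.mem_singleton, Multiset.mem_coe] at this
    rcases this with (h | h) | h
    · exact ih.2 r h
    · exact hn _ (hR.mem _ h)
    · rw [h]; exact ih.1

lemma Phi.le {b : ℤ} {n : Multiset Seg} {T z : ℤ} {M : Multiset Seg} (h : Phi b n T z M) :
    T ≤ b + 1 := by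
  induction h with
  | zero => simp
  | step n R T z M D z1 M1 hR hP hD hz hM ih => have := hD.2.1; omega

/-- z bounds -/
lemma Phi.z_le {b H : ℤ} {n : Multiset Seg} {T z : ℤ} {M : Multiset Seg} (h : Phi b n T z M)
    (hb : b ≤ H) (hn : ∀ r ∈ n, b ≤ r.2 ∧ r.2 ≤ H) : b ≤ z ∧ z ≤ H := by
  induction h with
  | zero => simp [hb]
  | step n R T z M D z1 M1 hR hP hD hz hM ih =>
    have ih := ih (fun r hr => hn r (Multiset.mem_of_le (Multiset.sub_le_self _ _) hr))
    rw [hz]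
    split_ifs
    · exact ih
    · exact hn _ (hR.mem _ hD.1)

lemma msetMax_some {s : Multiset ℤ} {x : ℤ} : msetMax s = some x ↔ x ∈ s ∧ ∀ y ∈ s, y ≤ x := by
  unfold msetMax
  split_ifs with h
  · simp [h]
  · simp only [Option.some.injEq]
    rw [Finset.max'_eq_iff]
    simp

lemma msetMin_some {s : Multiset ℤ} {x : ℤ} : msetMin s = some x ↔ x ∈ s ∧ ∀ y ∈ s, x ≤ y := by
  unfold msetMin
  split_ifs with h
  · simp [h]
  · simp only [Option.some.injEq]
    rw [Finset.min'_eq_iff]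
    simp

lemma msetMax_none {s : Multiset ℤ} : msetMax s = none ↔ s = 0 := by
  unfold msetMax
  split_ifs with h <;> simp [h]

lemma msetMin_none {s : Multiset ℤ} : msetMin s = none ↔ s = 0 := by
  unfold msetMin
  split_ifs with h <;> simp [h]

lemma usNext_none {n : Multiset Seg} {p : Seg} (h : usNext n p = none) :
    ∀ r ∈ n, ¬ Prec p r := by
  unfold usNext at h
  split at h
  · next h1 =>
    rw [msetMin_none] at h1
    intro r hr hp
    have : r.1 ∈ ((n.filter fun Δ => Prec p Δ).map Prod.fst) :=
      Multiset.mem_map_of_mem _ (Multiset.mem_filter.2 ⟨hr, hp⟩)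
    rw [h1] at this
    simp at this
  · next aj h1 =>
    rw [msetMin_some] at h1
    rw [Option.map_eq_none_iff, msetMax_none] at h
    obtain ⟨r, hr, hr2⟩ := Multiset.mem_map.1 h1.1
    have : r.2 ∈ ((((n.filter fun Δ => Prec p Δ).filter fun Δ => Δ.1 = aj)).map Prod.snd) :=
      Multiset.mem_map_of_mem _ (Multiset.mem_filter.2 ⟨hr, hr2⟩)
    rw [h] at this
    simp at this

lemma usNext_some {n : Multiset Seg} {p q : Seg} (h : usNext n p = some q) : Nx n p q := by
  unfold usNext at h
  split at h
  · simp at h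
  · next aj h1 =>
    rw [msetMin_some] at h1
    rw [Option.map_eq_some_iff] at h
    obtain ⟨y, hy, rfl⟩ := h
    rw [msetMax_some] at hy
    obtain ⟨r, hr, hr2⟩ := Multiset.mem_map.1 hy.1
    obtain ⟨hr3, hr4⟩ := Multiset.mem_filter.1 hr
    obtain ⟨hr5, hr6⟩ := Multiset.mem_filter.1 hr3
    have : r = (aj, y) := Prod.ext hr4 hr2
    subst this
    refine ⟨hr5, hr6, fun r hr hpr => ⟨?_, fun hh => ?_⟩⟩
    · exact h1.2 _ (Multiset.mem_map_of_mem _ (Multiset.mem_filter.2 ⟨hr, hpr⟩))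
    · exact hy.2 _ (Multiset.mem_map_of_mem _ (Multiset.mem_filter.2
        ⟨Multiset.mem_filter.2 ⟨hr, hpr⟩, hh⟩))

lemma usAux_chain (n : Multiset Seg) : ∀ (k : ℕ) (p : Seg),
    (n.filter fun r => p.1 < r.1).card ≤ k → Chain n p (usAux n k p)
  | 0, p, h => by
    refine Chain.nil p fun r hr hp => ?_
    have : r ∈ (n.filter fun r => p.1 < r.1) := Multiset.mem_filter.2 ⟨hr, hp.1⟩
    have := Multiset.card_pos_iff_exists_mem.2 ⟨_, this⟩
    omega
  | k + 1, p, h => by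
    unfold usAux
    split
    · next h1 => exact Chain.nil p (usNext_none h1)
    · next q h1 =>
      have hq := usNext_some h1
      refine Chain.cons p q _ hq (usAux_chain n k q ?_)
      have : (n.filter fun r => q.1 < r.1) < (n.filter fun r => p.1 < r.1) := by
        refine lt_of_le_of_ne ?_ ?_
        · refine Multiset.monotone_filter_right n ?_
          intro r hr
          have := hq.2.1.1
          omega
        · intro he
          have : q ∈ (n.filter fun r => p.1 < r.1) := Multiset.mem_filter.2 ⟨hq.1, hq.2.1.1⟩
          rw [← he] at this
          simp at this
      have := Multiset.card_lt_card this
      omega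

lemma usList_row {n : Multiset Seg} (hn : n ≠ 0) : IsRow n (usList n) := by
  unfold usList
  split
  · next h1 =>
    rw [msetMin_none, Multiset.map_eq_zero] at h1
    exact absurd h1 hn
  · next a1 h1 =>
    rw [msetMin_some] at h1
    split
    · next h2 =>
      exfalso
      unfold longStart startAt at h2
      rw [Option.map_eq_none_iff, msetMax_none] at h2
      obtain ⟨r, hr, hr2⟩ := Multiset.mem_map.1 h1.1
      have : r.2 ∈ ((n.filter fun Δ => Δ.1 = a1).map Prod.snd) :=
        Multiset.mem_map_of_mem _ (Multiset.mem_filter.2 ⟨hr, hr2⟩)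
      rw [h2] at this
      simp at this
    · next D1 h2 =>
      unfold longStart startAt at h2
      rw [Option.map_eq_some_iff] at h2
      obtain ⟨y, hy, rfl⟩ := h2
      rw [msetMax_some] at hy
      obtain ⟨r, hr, hr2⟩ := Multiset.mem_map.1 hy.1
      obtain ⟨hr3, hr4⟩ := Multiset.mem_filter.1 hr
      obtain rfl : r = (a1, y) := Prod.ext hr4 hr2
      refine ⟨_, _, rfl, hr3, fun r hr => ⟨h1.2 _ (Multiset.mem_map_of_mem _ hr), fun hh =>
        hy.2 _ (Multiset.mem_map_of_mem _ (Multiset.mem_filter.2 ⟨hr, hh⟩))⟩, ?_⟩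
      exact usAux_chain n _ _ (Multiset.card_le_card (Multiset.filter_le _ _))

lemma findRow_pick : ∀ (R : List Seg) (T : ℤ) (D : Seg), R.Pairwise (fun x y => x.1 < y.1) →
    (∀ r ∈ R, T - 1 ≤ r.2) → (∀ p ∈ R.head?, p.1 ≤ T) → Pick R T D →
    findRowD R (T - 1) = some D
  | [], T, D, _, _, _, hD => by simp [Pick] at hD
  | [p], T, D, hR, h2, hh, hD => by
    have := hD.1
    simp only [List.mem_singleton] at this
    subst this
    have := h2 D (by simp)
    simp [findRowD, intSubB, this]
  | p :: q :: l, T, D, hR, h2, hh, hD => by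
    have hp : p.1 ≤ T := hh p (by simp)
    rw [List.pairwise_cons] at hR
    unfold findRowD
    by_cases hq : q.1 ≤ T
    · have hpq := hR.1 q (by simp)
      have : intSubB p.1 (T - 1) p.1 (q.1 - 2) = false := by
        simp [intSubB]
        constructor <;> omega
      rw [this]
      simp only [Bool.false_eq_true, if_false]
      refine findRow_pick (q :: l) T D hR.2 (fun r hr => h2 r (List.mem_cons_of_mem _ hr))
        (by simpa using hq) ⟨?_, hD.2.1, fun r hr => hD.2.2 r (List.mem_cons_of_mem _ hr)⟩
      rcases List.mem_cons.1 hD.1 with rfl | h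
      · have := hD.2.2 q (by simp) hq
        omega
      · exact h
    · have hDp : Pick (p :: q :: l) T p := by
        refine ⟨by simp, hp, fun r hr hrT => ?_⟩
        rcases List.mem_cons.1 hr with rfl | h
        · exact le_rfl
        · rw [List.pairwise_cons] at hR
          rcases List.mem_cons.1 h with rfl | h
          · omega
          · have := hR.2.1 r h
            omega
      obtain rfl := hD.unique (List.pairwise_cons.2 hR) hDp
      have : intSubB D.1 (T - 1) D.1 (q.1 - 2) = true := by
        simp [intSubB]
        omega
      rw [this]
      simp

def fin' (S : List (Seg × ℤ)) (top : ℤ) : ℤ :=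
  match S.getLast? with
  | none => top
  | some q => q.1.1 - 1

lemma fin_cons (p : Seg × ℤ) (S : List (Seg × ℤ)) (top : ℤ) :
    fin' (p :: S) top = fin' S (p.1.1 - 1) := by
  cases S with
  | nil => rfl
  | cons q S =>
    unfold fin'
    rw [List.getLast?_cons_cons]
    cases h : (q :: S).getLast? with
    | none => simp at h
    | some w => rfl

lemma fin_append (S : List (Seg × ℤ)) (p : Seg × ℤ) (top : ℤ) :
    fin' (S ++ [p]) top = p.1.1 - 1 := by
  simp [fin']

lemma selAuxD_cons (R : List Seg) (rows : List (List Seg)) : ∀ (k : ℕ) (top : ℤ),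
    selAuxD (R :: rows) (k + 1) top = selAuxD rows k top ++
      (match findRowD R (fin' (selAuxD rows k top) top) with
       | some D => [(D, fin' (selAuxD rows k top) top + 1)]
       | none => [])
  | 0, top => by
    simp only [selAuxD, List.getD_cons_zero, fin', List.getLast?_nil, List.nil_append]
    all_goals (cases findRowD R top <;> rfl)
  | k + 1, top => by
    rw [selAuxD, List.getD_cons_succ]
    conv_rhs => rw [selAuxD]
    cases h : findRowD (rows.getD k []) top with
    | none =>
      simp only
      exact selAuxD_cons R rows k top
    | some D =>
      simp only [fin_cons]
      rw [selAuxD_cons R rows k (D.1 - 1)]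
      simp

lemma exists_pick {n : Multiset Seg} {R : List Seg} (hR : IsRow n R) {T : ℤ}
    (h : ∀ p ∈ R.head?, p.1 ≤ T) : ∃ D, Pick R T D := by
  have hne : (R.filter fun r => r.1 ≤ T) ≠ [] := by
    obtain ⟨p, l, rfl, -⟩ := hR
    have := h p (by simp)
    simp [this]
  obtain ⟨D, hD, hm⟩ := (R.filter fun r => r.1 ≤ T).toFinset.exists_max_image (fun r => r.1)
    (by simpa [Finset.nonempty_iff_ne_empty] using hne)
  simp at hD
  refine ⟨D, hD.1, hD.2, fun r hr hrT => hm r (by simp [hr, hrT])⟩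

lemma row_head_le {b : ℤ} {n : Multiset Seg} {R : List Seg} (hR : IsRow n R) {T z : ℤ}
    {M : Multiset Seg} (hn : ∀ r ∈ n, r.1 ≤ b + 1)
    (h : Phi b (n - (R : Multiset Seg)) T z M) : ∀ p ∈ R.head?, p.1 ≤ T := by
  obtain ⟨p, l, rfl, hp, hp2, hl⟩ := hR
  intro q hq
  simp at hq
  subst hq
  exact (h.ge (hn p hp)
    (fun r hr => (hp2 r (Multiset.mem_of_le (Multiset.sub_le_self _ _) hr)).1)).1

lemma exists_Phi (b : ℤ) : ∀ (k : ℕ) (n : Multiset Seg), n.card ≤ k → (∀ r ∈ n, r.1 ≤ b + 1) →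
    ∃ T z M, Phi b n T z M
  | 0, n, hk, _ => by
    obtain rfl : n = 0 := by simpa using hk
    exact ⟨_, _, _, Phi.zero⟩
  | k + 1, n, hk, hn => by
    by_cases h0 : n = 0
    · subst h0; exact ⟨_, _, _, Phi.zero⟩
    have hR := usList_row h0
    obtain ⟨T, z, M, h⟩ := exists_Phi b k (n - (usList n : Multiset Seg))
      (by have := hR.card; omega)
      (fun r hr => hn r (Multiset.mem_of_le (Multiset.sub_le_self _ _) hr))
    obtain ⟨D, hD⟩ := exists_pick hR (row_head_le hR hn h)
    refine ⟨_, _, (M + (usList n : Multiset Seg) + {(T, D.2)}).erase D,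
      Phi.step n _ T z M D _ _ hR h hD rfl ?_⟩
    have hm : D ∈ M + (usList n : Multiset Seg) + {(T, D.2)} := by simp [hD.1]
    rw [add_comm, Multiset.singleton_add, Multiset.cons_erase hm]

/-- non-void segments -/
def filt (M : Multiset Seg) : Multiset Seg := M.filter fun r => r.1 ≤ r.2

lemma filt_add (A B : Multiset Seg) : filt (A + B) = filt A + filt B := Multiset.filter_add _ _ _

lemma pushSeg_eq (m : Multiset Seg) (x y : ℤ) : pushSeg m x y = m + filt {(x, y)} := by
  unfold pushSeg filt
  split_ifs with h
  · rw [Multiset.filter_singleton, if_pos h]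
  · rw [Multiset.filter_singleton, if_neg h]; simp

lemma filt_self {M : Multiset Seg} (h : IsMS M) : filt M = M := Multiset.filter_eq_self.2 h

def ap (m : Multiset Seg) (sel : List (Seg × ℤ)) : Multiset Seg :=
  sel.foldl (fun acc p => pushSeg (acc.erase p.1) p.2 p.1.2) m

lemma Phi_link {b : ℤ} {n : Multiset Seg} {T z : ℤ} {M : Multiset Seg} (h : Phi b n T z M)
    (hn : ∀ r ∈ n, r.1 ≤ b + 1 ∧ b ≤ r.2 ∧ r.1 ≤ r.2) :
    ∀ k, n.card ≤ k → fin' (selAuxD (usDecomp k n) (usDecomp k n).length b) b = T - 1 ∧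
      ∀ m, n ≤ m → ap m (selAuxD (usDecomp k n) (usDecomp k n).length b) + n = m + filt M := by
  induction h with
  | zero =>
    intro k _
    have : usDecomp k 0 = [] := by cases k <;> simp [usDecomp]
    rw [this]
    simp [selAuxD, fin', ap, filt]
  | step n R T z M D z1 M1 hR hP hD hz hM ih =>
    intro k hk
    have hn0 := hR.ne
    obtain rfl := hR.unique (usList_row hn0)
    have hsub : ∀ r ∈ n - (usList n : Multiset Seg), r ∈ n := fun r hr =>
      Multiset.mem_of_le (Multiset.sub_le_self _ _) hr
    cases k with
    | zero => simp at hk; exact absurd hk hn0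
    | succ k =>
      have hc := hR.card
      obtain ⟨ih1, ih2⟩ := ih (fun r hr => hn r (hsub r hr)) k (by omega)
      have hrow : usDecomp (k + 1) n =
        usList n :: usDecomp k (n - (usList n : Multiset Seg)) := by
        simp [usDecomp, hn0]
      rw [hrow, List.length_cons, selAuxD_cons, ih1]
      have hT := hP.le
      have hf := findRow_pick (usList n) T D hR.pw
        (fun r hr => by have := hn r (hR.mem r hr); omega)
        (row_head_le hR (fun r hr => (hn r hr).1) hP) hD
      rw [hf]
      simp only
      refine ⟨fin_append _ _ _, fun m hm => ?_⟩
      have e := ih2 m (le_trans (Multiset.sub_le_self _ _) hm)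
      set S := selAuxD (usDecomp k (n - (usList n : Multiset Seg)))
        (usDecomp k (n - (usList n : Multiset Seg))).length b with hS
      have e2 : ap m (S ++ [(D, T - 1 + 1)]) = pushSeg ((ap m S).erase D) T D.2 := by
        simp [ap]
      rw [e2, pushSeg_eq]
      have hle : n - (usList n : Multiset Seg) + (usList n : Multiset Seg) = n :=
        Multiset.sub_add_cancel hR.le
      have hRle : (usList n : Multiset Seg) ≤ ap m S := by
        have : (usList n : Multiset Seg) + (n - (usList n : Multiset Seg)) ≤
            ap m S + (n - (usList n : Multiset Seg)) := by
          rw [e, add_comm, hle]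
          exact le_trans hm (Multiset.le_add_right _ _)
        exact le_of_add_le_add_right this
      have hDm : D ∈ ap m S := Multiset.mem_of_le hRle (by simpa using hD.1)
      have e3 : (ap m S).erase D + {D} = ap m S := by
        rw [add_comm, Multiset.singleton_add, Multiset.cons_erase hDm]
      have fM := congrArg filt hM
      simp only [filt_add] at fM
      rw [filt_self (M := {D}) (by
        intro r hr
        have : r = D := by simpa using hr
        rw [this]; exact (hn D (hR.mem D hD.1)).2.2),
        filt_self (M := (usList n : Multiset Seg)) (fun r hr =>
          (hn r (hR.mem r (by simpa using hr))).2.2)] at fM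
      apply add_right_cancel (b := ({D} : Multiset Seg))
      calc (ap m S).erase D + filt {(T, D.2)} + n + {D}
          = ((ap m S).erase D + {D}) + filt {(T, D.2)} + n := by abel
        _ = ap m S + filt {(T, D.2)} + (n - (usList n : Multiset Seg) + (usList n : Multiset Seg)) := by
            rw [e3, hle]
        _ = (ap m S + (n - (usList n : Multiset Seg))) + (usList n : Multiset Seg) + filt {(T, D.2)} := by
            generalize n - (usList n : Multiset Seg) = u
            abel
        _ = m + (filt M + (usList n : Multiset Seg) + filt {(T, D.2)}) := by rw [e]; abel
        _ = m + filt M1 + {D} := by rw [← fM]; abel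

lemma DLang_iff {m : Multiset Seg} (hm : IsMS m) {a b : ℤ} (hab : a < b) {T z : ℤ}
    {M : Multiset Seg} (h : Phi b (mRange m a b) T z M) (X : Multiset Seg) :
    DLang a b m = some X ↔ T = a ∧ X + mRange m a b = m + filt M := by
  have hle : mRange m a b ≤ m := Multiset.filter_le _ _
  obtain ⟨h1, h2⟩ := Phi_link h (fun r hr => by
    have h3 := (Multiset.mem_filter.1 hr).2
    exact ⟨h3.2.1, h3.2.2, hm r (Multiset.mem_of_le hle hr)⟩) _ le_rfl
  have h2 := h2 m hle
  unfold DLang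
  simp only
  unfold ap at h2
  unfold fin' at h1
  rw [← h2]
  cases hs : (selAuxD (usDecomp (mRange m a b).card (mRange m a b))
          (usDecomp (mRange m a b).card (mRange m a b)).length b).getLast? with
  | none =>
    rw [hs] at h1
    simp only at h1
    simp
    omega
  | some q =>
    rw [hs] at h1
    simp only at h1
    simp only
    have : (q.1.1 = a) ↔ T = a := by omega
    simp only [this]
    split_ifs with hT
    · simp only [hT, true_and, Option.some.injEq]
      constructor
      · rintro rfl; rfl
      · intro h; exact (add_right_cancel h).symm
    · simp [hT]

lemma uu_pair {e c e' c' : ℕ → ℕ} {t0 t1 : ℕ} (h01 : t1 < t0) (he : ∀ t, e' t + dl t0 t = e t)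
    (hc : ∀ t, c' t + dl t1 t = c t) (hz : ∀ t, t1 < t → t < t0 → e t = 0) (t : ℕ) :
    uu e' c' t = uu e c t := by
  have key : ∀ t, (t ≤ t1 → Qw e' c' t = Qw e c t) ∧
      (t1 < t → t ≤ t0 → Qw e' c' t + 1 = Qw e c t) ∧ (t0 < t → Qw e' c' t = Qw e c t) := by
    intro t
    induction t with
    | zero => simp [Qw]
    | succ t ih =>
      have h1 := he t
      have h2 := hc t
      have h3 := hz t
      simp only [Qw]
      unfold dl at h1 h2
      split_ifs at h1 h2 <;> refine ⟨fun _ => ?_, fun _ _ => ?_, fun _ => ?_⟩ <;> omega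
  have k := key t
  have h1 := he t
  have h3 := hz t
  unfold uu
  unfold dl at h1
  split_ifs at h1 <;> omega

lemma uu_single {e c e' : ℕ → ℕ} {t0 : ℕ} (he : ∀ t, e' t + dl t0 t = e t)
    (hc : ∀ t, t < t0 → c t = 0) (t : ℕ) :
    uu e c t = uu e' c t + dl t0 t := by
  have key : ∀ t, (t ≤ t0 → Qw e' c t = 0 ∧ Qw e c t = 0) ∧
      (t0 < t → Qw e' c t = Qw e c t) := by
    intro t
    induction t with
    | zero => simp [Qw]
    | succ t ih =>
      have h1 := he t
      have h2 := hc t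
      simp only [Qw]
      unfold dl at h1
      split_ifs at h1 <;> refine ⟨fun _ => ?_, fun _ => ?_⟩ <;> omega
  have k := key t
  have h1 := he t
  unfold uu
  unfold dl at *
  split_ifs at * <;> omega

lemma uu_zero {e c : ℕ → ℕ} {t : ℕ} (h : e t = 0) : uu e c t = 0 := by simp [uu, h]

def col (H : ℤ) (n : Multiset Seg) (s : ℤ) (t : ℕ) : ℕ := n.count (s, H - t)

lemma mem_col {H : ℤ} {n : Multiset Seg} {s : ℤ} {t : ℕ} :
    (s, H - (t : ℤ)) ∈ n ↔ 0 < col H n s t := by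
  unfold col; rw [Multiset.count_pos]

lemma idx {H e : ℤ} (h : e ≤ H) : ∃ t : ℕ, e = H - t := ⟨(H - e).toNat, by omega⟩

structure Hat (H a b : ℤ) (n n' : Multiset Seg) : Prop where
  rng : ∀ r ∈ n, a ≤ r.1 ∧ r.1 ≤ b + 1 ∧ b ≤ r.2 ∧ r.2 ≤ H
  rng' : ∀ r ∈ n', a + 1 ≤ r.1 ∧ r.1 ≤ b + 1 ∧ b ≤ r.2 ∧ r.2 ≤ H
  hi : ∀ s e, a + 2 ≤ s → n.count (s, e) = n'.count (s, e)
  f : ∀ t, col H n' (a + 1) t = ff (col H n a) (col H n (a + 1)) t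

abbrev U (H a : ℤ) (n : Multiset Seg) : ℕ → ℕ := uu (col H n a) (col H n (a + 1))

lemma Hat.himem {H a b : ℤ} {n n' : Multiset Seg} (h : Hat H a b n n') {r : Seg}
    (hr : a + 2 ≤ r.1) : r ∈ n ↔ r ∈ n' := by
  rw [← Multiset.count_pos, ← Multiset.count_pos, h.hi r.1 r.2 hr]

lemma Hat.sub {H a b : ℤ} {n n' : Multiset Seg} (h : Hat H a b n n') {R R' : Multiset Seg}
    (hi : ∀ s e, a + 2 ≤ s → R.count (s, e) = R'.count (s, e))
    (f : ∀ t, col H (n' - R') (a + 1) t = ff (col H (n - R) a) (col H (n - R) (a + 1)) t) :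
    Hat H a b (n - R) (n' - R') where
  rng := fun r hr => h.rng r (Multiset.mem_of_le (Multiset.sub_le_self _ _) hr)
  rng' := fun r hr => h.rng' r (Multiset.mem_of_le (Multiset.sub_le_self _ _) hr)
  hi := fun s e hs => by rw [Multiset.count_sub, Multiset.count_sub, hi s e hs, h.hi s e hs]
  f := f

lemma col_sub (H : ℤ) (n R : Multiset Seg) (s : ℤ) (t : ℕ) :
    col H (n - R) s t = col H n s t - col H R s t := by
  unfold col; rw [Multiset.count_sub]

lemma col_cons_eq (H : ℤ) (l : List Seg) (s : ℤ) (t0 t : ℕ) :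
    col H (((s, H - (t0 : ℤ)) :: l : List Seg) : Multiset Seg) s t =
      col H (l : Multiset Seg) s t + dl t0 t := by
  unfold col dl
  simp only [Multiset.coe_count, List.count_cons]
  congr 1
  by_cases h : t = t0
  · simp [h]
  · have : ¬ ((s, H - (t0 : ℤ)) = (s, H - (t : ℤ))) := by
      simp; omega
    simp [h]
    omega

lemma col_cons_ne (H : ℤ) (l : List Seg) (s s' e : ℤ) (t : ℕ) (h : s' ≠ s) :
    col H (((s', e) :: l : List Seg) : Multiset Seg) s t = col H (l : Multiset Seg) s t := by
  unfold col
  simp only [Multiset.coe_count, List.count_cons]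
  simp [h]

lemma col_lo {H s : ℤ} {l : List Seg} (h : ∀ r ∈ l, s < r.1) (t : ℕ) :
    col H (l : Multiset Seg) s t = 0 := by
  unfold col
  rw [Multiset.count_eq_zero]
  intro hm
  have := h _ (by simpa using hm)
  simp at this

lemma hi_cons (a : ℤ) (l : List Seg) (p : Seg) (hp : p.1 ≤ a + 1) (s e : ℤ) (hs : a + 2 ≤ s) :
    ((p :: l : List Seg) : Multiset Seg).count (s, e) = (l : Multiset Seg).count (s, e) := by
  simp only [Multiset.coe_count, List.count_cons]
  have : ¬ (p = (s, e)) := by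
    rintro rfl
    simp at hp
    omega
  simp [this]

/-- Row comparison. -/
lemma row_cmp {H a b : ℤ} {n n' : Multiset Seg} (hab : a ≤ b) (h : Hat H a b n n') {R : List Seg}
    (hR : IsRow n R) (hlo : ∃ r ∈ n, r.1 ≤ a + 1) :
    ∃ (tail : List Seg) (t0 : ℕ), (∀ r ∈ tail, a + 2 ≤ r.1) ∧
      IsRow n' ((a + 1, H - (t0 : ℤ)) :: tail) ∧
      Hat H a b (n - (R : Multiset Seg))
        (n' - (((a + 1, H - (t0 : ℤ)) :: tail : List Seg) : Multiset Seg)) ∧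
      ((R = (a, H - (t0 : ℤ)) :: tail ∧
          (∀ t, U H a n t = U H a (n - (R : Multiset Seg)) t + dl t0 t) ∧
          (∀ t, 0 < col H n a t → t0 ≤ t)) ∨
       (R = (a + 1, H - (t0 : ℤ)) :: tail ∧ ∀ t, col H n a t = 0) ∨
       (∃ t00, t0 < t00 ∧ R = (a, H - (t00 : ℤ)) :: (a + 1, H - (t0 : ℤ)) :: tail ∧
          (∀ t, U H a n t = U H a (n - (R : Multiset Seg)) t) ∧
          (∀ t, 0 < col H n a t → t00 ≤ t))) := by
  have hRle := hR.le
  obtain ⟨p, l, rfl, hp, hp2, hl⟩ := hR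
  obtain ⟨r0, hr0, hr0'⟩ := hlo
  have hpl := (hp2 r0 hr0).1
  have hpr := h.rng p hp
  obtain ⟨ps, pe⟩ := p
  obtain ⟨t0, rfl⟩ := idx hpr.2.2.2
  simp only at *
  have cmem : ∀ (s : ℤ) (t : ℕ), (s, H - (t : ℤ)) ∈ n ↔ 0 < col H n s t := fun s t => mem_col
  rcases (by omega : ps = a ∨ ps = a + 1) with rfl | rfl
  · have hc0 : ∀ t, 0 < col H n ps t → t0 ≤ t := by
      intro t ht
      have := (hp2 _ ((cmem _ _).2 ht)).2 rfl
      simp at this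
      omega
    have hpos0 : 0 < col H n ps t0 := (cmem _ _).1 hp
    by_cases hq : ∃ r ∈ n, r.1 = ps + 1 ∧ H - (t0 : ℤ) < r.2
    · obtain ⟨r, hr, hr1, hr2⟩ := hq
      have hPr : Prec (ps, H - (t0 : ℤ)) r := ⟨by simp; omega, by simp; omega, by simp; omega⟩
      cases hl with
      | nil _ h0 => exact absurd hPr (h0 r hr)
      | cons _ q tail hq hl =>
        have hq1 := (hq.2.2 r hr hPr).1
        have hq2 := hq.2.1
        have hqm := hq.1
        have hqr := h.rng q hqm
        obtain ⟨qs, qe⟩ := q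
        obtain ⟨t1, rfl⟩ := idx hqr.2.2.2
        obtain ⟨hq3, hq4, hq5⟩ := hq2
        simp only at *
        obtain rfl : qs = ps + 1 := by omega
        have ht10 : t1 < t0 := by omega
        have hc1 : ∀ t, 0 < col H n (ps + 1) t → t1 ≤ t := by
          intro t ht
          by_contra hlt
          have := (hq.2.2 _ ((cmem _ _).2 ht) ⟨by simp, by simp; omega, by simp; omega⟩).2 rfl
          simp at this
          omega
        have htail : ∀ r ∈ tail, ps + 2 ≤ r.1 := fun r hr => by
          have := (hl.gt r hr).1
          simp at this
          omega
        have hpos1 : 0 < col H n (ps + 1) t1 := (cmem _ _).1 hqm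
        have eA : ∀ t, col H (n - (((ps, H - (t0 : ℤ)) :: (ps + 1, H - (t1 : ℤ)) :: tail : List Seg) : Multiset Seg)) ps t + dl t0 t = col H n ps t := by
          intro t
          rw [col_sub, col_cons_eq, col_cons_ne _ _ _ _ _ _ (by omega),
            col_lo (fun r hr => by have := htail r hr; omega)]
          unfold dl
          split_ifs with hh
          · subst hh; omega
          · omega
        have eB : ∀ t, col H (n - (((ps, H - (t0 : ℤ)) :: (ps + 1, H - (t1 : ℤ)) :: tail : List Seg) : Multiset Seg)) (ps + 1) t + dl t1 t = col H n (ps + 1) t := by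
          intro t
          rw [col_sub, col_cons_ne _ _ _ _ _ _ (by omega), col_cons_eq,
            col_lo (fun r hr => by have := htail r hr; omega)]
          unfold dl
          split_ifs with hh
          · subst hh; omega
          · omega
        have hU := uu_pair ht10 eA eB (fun t h1 h2 => by
          by_contra hh
          have := hc0 t (by omega)
          omega)
        refine ⟨tail, t1, htail, ⟨_, _, rfl, ?_, ?_, ?_⟩, ?_, Or.inr (Or.inr ⟨t0, ht10, rfl,
          fun t => (hU t).symm, hc0⟩)⟩
        · rw [mem_col, h.f]; unfold ff; omega
        · intro r hr
          refine ⟨(h.rng' r hr).1, fun hr1 => ?_⟩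
          have hrr := h.rng' r hr
          obtain ⟨rs, re⟩ := r
          obtain ⟨t, rfl⟩ := idx hrr.2.2.2
          simp only at *
          subst hr1
          rw [mem_col, h.f] at hr
          unfold ff at hr
          have : t1 ≤ t := by
            by_contra hlt
            have h1 : col H n (ps + 1) t = 0 := by
              by_contra hh
              have := hc1 t (by omega)
              omega
            have h2 : col H n ps t = 0 := by
              by_contra hh
              have := hc0 t (by omega)
              omega
            rw [uu_zero h2] at hr
            omega
          omega
        · refine hl.congr fun r hr => h.himem ?_
          simp at hr
          omega
        · refine h.sub (fun s e hs => ?_) (fun t => ?_)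
          · rw [hi_cons ps _ _ (by simp) s e hs]
          · have h1 := h.f t
            have h2 := eB t
            have h3 := hU t
            rw [col_sub, col_cons_eq, col_lo (fun r hr => by have := htail r hr; omega)]
            unfold ff at *
            omega
    · push Not at hq
      have hc1 : ∀ t, t < t0 → col H n (ps + 1) t = 0 := by
        intro t ht
        by_contra hh
        have := hq _ ((cmem (ps + 1) t).2 (by omega)) rfl
        simp at this
        omega
      have htail : ∀ r ∈ l, ps + 2 ≤ r.1 := fun r hr => by
        have h1 := hl.gt r hr
        have h2 := hq r h1.2.2
        simp at h1
        by_contra hlt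
        have := h2 (by omega)
        omega
      have eA : ∀ t, col H (n - (((ps, H - (t0 : ℤ)) :: l : List Seg) : Multiset Seg)) ps t + dl t0 t = col H n ps t := by
        intro t
        rw [col_sub, col_cons_eq,
          col_lo (fun r hr => by have := htail r hr; omega)]
        unfold dl
        split_ifs with hh
        · subst hh; omega
        · omega
      have eB : ∀ t, col H (n - (((ps, H - (t0 : ℤ)) :: l : List Seg) : Multiset Seg)) (ps + 1) t = col H n (ps + 1) t := by
        intro t
        rw [col_sub, col_cons_ne _ _ _ _ _ _ (by omega),
          col_lo (fun r hr => by have := htail r hr; omega)]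
        omega
      have hU := uu_single eA hc1
      have hUt : 0 < U H ps n t0 := by
        have := hU t0
        rw [dl_self] at this
        unfold U; omega
      have eB' := funext eB
      refine ⟨l, t0, htail, ⟨_, _, rfl, ?_, ?_, ?_⟩, ?_, Or.inl ⟨rfl, ?_, hc0⟩⟩
      · rw [mem_col, h.f]; unfold ff; unfold U at hUt; omega
      · intro r hr
        refine ⟨(h.rng' r hr).1, fun hr1 => ?_⟩
        have hrr := h.rng' r hr
        obtain ⟨rs, re⟩ := r
        obtain ⟨t, rfl⟩ := idx hrr.2.2.2
        simp only at *
        subst hr1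
        rw [mem_col, h.f] at hr
        unfold ff at hr
        have : t0 ≤ t := by
          by_contra hlt
          have h1 := hc1 t (by omega)
          have h2 : col H n ps t = 0 := by
            by_contra hh
            have := hc0 t (by omega)
            omega
          rw [uu_zero h2] at hr
          omega
        omega
      · cases hl with
        | nil _ h0 =>
          refine Chain.nil _ fun r hr hPr => ?_
          obtain ⟨k1, k2, k3⟩ := hPr
          simp only at k1 k2 k3
          exact h0 r ((h.himem (by omega)).2 hr) ⟨by simp; omega, by simp; omega, by simp; omega⟩
        | cons _ q tail hq' hl =>
          have hq2 := htail q (by simp)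
          refine Chain.cons _ q tail ⟨(h.himem hq2).1 hq'.1, ?_, fun r hr hPr => ?_⟩
            (hl.congr fun r hr => h.himem (by omega))
          · obtain ⟨k1, k2, k3⟩ := hq'.2.1
            simp only at k1 k2 k3
            exact ⟨by simp; omega, by simp; omega, by simp; omega⟩
          · obtain ⟨k1, k2, k3⟩ := hPr
            simp only at k1 k2 k3
            exact hq'.2.2 r ((h.himem (by omega)).2 hr)
              ⟨by simp; omega, by simp; omega, by simp; omega⟩
      · refine h.sub (fun s e hs => ?_) (fun t => ?_)
        · rw [hi_cons ps _ _ (by simp) s e hs, hi_cons ps _ _ (by simp) s e hs]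
        · have h1 := h.f t
          have h2 := eB t
          have h3 := hU t
          rw [col_sub, col_cons_eq, col_lo (fun r hr => by have := htail r hr; omega)]
          unfold ff at *
          rw [eB']
          omega
      · intro t
        unfold U
        rw [eB']
        exact hU t
  · have hc0 : ∀ t, col H n a t = 0 := by
      intro t
      by_contra hh
      have := (hp2 _ ((cmem _ _).2 (by omega : 0 < col H n a t))).1
      simp at this
    have hcc : ∀ t, col H n' (a + 1) t = col H n (a + 1) t := by
      intro t
      rw [h.f]; unfold ff; rw [uu_zero (hc0 t)]; omega
    have htail : ∀ r ∈ l, a + 2 ≤ r.1 := fun r hr => by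
      have := (hl.gt r hr).1
      simp at this
      omega
    refine ⟨l, t0, htail, ⟨_, _, rfl, ?_, ?_, ?_⟩, ?_, Or.inr (Or.inl ⟨rfl, hc0⟩)⟩
    · rw [mem_col, hcc, ← mem_col]; exact hp
    · intro r hr
      refine ⟨(h.rng' r hr).1, fun hr1 => ?_⟩
      have hrr := h.rng' r hr
      obtain ⟨rs, re⟩ := r
      obtain ⟨t, rfl⟩ := idx hrr.2.2.2
      simp only at *
      subst hr1
      rw [mem_col, hcc, ← mem_col] at hr
      exact (hp2 _ hr).2 rfl
    · refine hl.congr fun r hr => h.himem ?_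
      simp at hr
      omega
    · refine h.sub (fun s e hs => rfl) (fun t => ?_)
      have h1 := hcc t
      have h2 := hc0 t
      unfold ff
      rw [uu_zero (by rw [col_sub, h2]; omega), col_sub, col_sub, h1]
      omega

def ci (H : ℤ) (D : Seg) (s : ℤ) (t : ℕ) : ℕ := if D = (s, H - (t : ℤ)) then 1 else 0

lemma ci_eq (H s : ℤ) (t0 t : ℕ) : ci H (s, H - (t0 : ℤ)) s t = dl t0 t := by
  unfold ci dl
  simp only [Prod.mk.injEq, true_and]
  congr 1
  simp only [eq_iff_iff]
  omega

lemma ci_ne {H s : ℤ} {D : Seg} (h : D.1 ≠ s) (t : ℕ) : ci H D s t = 0 := by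
  unfold ci
  rw [if_neg]
  rintro rfl
  exact h rfl

lemma count_step {n M M1 : Multiset Seg} {R : List Seg} {D D' : Seg}
    (hR : (R : Multiset Seg) ≤ n) (hM : M + {D} = M1 + (R : Multiset Seg) + {D'}) (r : Seg) :
    M.count r + (if D = r then 1 else 0) + (n - (R : Multiset Seg)).count r =
      M1.count r + n.count r + (if D' = r then 1 else 0) := by
  have h1 := congrArg (Multiset.count r) hM
  have h2 := Multiset.count_le_of_le r hR
  simp only [Multiset.count_add, Multiset.count_singleton] at h1
  rw [Multiset.count_sub]
  simp only [eq_comm (a := r)] at h1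
  omega

lemma col_step {n M M1 : Multiset Seg} {R : List Seg} {D D' : Seg}
    (hR : (R : Multiset Seg) ≤ n) (hM : M + {D} = M1 + (R : Multiset Seg) + {D'}) (H s : ℤ)
    (t : ℕ) :
    col H M s t + ci H D s t + col H (n - (R : Multiset Seg)) s t =
      col H M1 s t + col H n s t + ci H D' s t := count_step hR hM _

/-- correction term -/
def Vt (H a b : ℤ) (t : ℕ) : ℕ := if a = b then dl (H - b).toNat t else 0

structure RedA (H a : ℤ) (n n' : Multiset Seg) (T z : ℤ) (M : Multiset Seg) (T' z' : ℤ)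
    (M' : Multiset Seg) : Prop where
  hT' : a + 1 < T'
  hT : T = T'
  hz : z = z'
  c0 : ∀ t, col H M a t = col H n a t
  c1 : ∀ t, col H M (a + 1) t = col H n (a + 1) t
  c' : ∀ t, col H M' (a + 1) t = col H n' (a + 1) t

structure RedB (H a b : ℤ) (n n' : Multiset Seg) (T' z' : ℤ) (M' : Multiset Seg) (x : ℕ) :
    Prop where
  hT' : T' = a + 1
  hz' : z' = H - x
  c' : ∀ t, col H M' (a + 1) t + dl x t = col H n' (a + 1) t + Vt H a b t

structure RedB1 (H a b : ℤ) (n : Multiset Seg) (T z : ℤ) (M : Multiset Seg) (x y : ℕ) :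
    Prop where
  hT : T = a
  hz : z = H - y
  hy : IsLast (U H a n) x y
  c0 : ∀ t, col H M a t + dl y t = col H n a t
  c1 : ∀ t, col H M (a + 1) t + dl x t = col H n (a + 1) t + Vt H a b t + dl y t

structure RedB2 (H a b : ℤ) (n : Multiset Seg) (T z : ℤ) (M : Multiset Seg) (x : ℕ) :
    Prop where
  hT : T = a + 1
  hz : z = H - x
  hy : ∀ t ≤ x, U H a n t = 0
  c0 : ∀ t, col H M a t = col H n a t
  c1 : ∀ t, col H M (a + 1) t + dl x t = col H n (a + 1) t + Vt H a b t

def RedC (H a b : ℤ) (n n' : Multiset Seg) (T z : ℤ) (M : Multiset Seg) (T' z' : ℤ)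
    (M' : Multiset Seg) : Prop :=
  (∀ s e, a + 2 ≤ s → M.count (s, e) = M'.count (s, e)) ∧
  (RedA H a n n' T z M T' z' M' ∨ ∃ x, RedB H a b n n' T' z' M' x ∧
    (RedB2 H a b n T z M x ∨ ∃ y, RedB1 H a b n T z M x y))

lemma col_hi {H s : ℤ} {n : Multiset Seg} (h : ∀ r ∈ n, s < r.1) (t : ℕ) :
    col H n s t = 0 := by
  unfold col
  rw [Multiset.count_eq_zero]
  intro hm
  have := h _ hm
  simp at this

lemma red_base {H a b : ℤ} (hab : a ≤ b) (hH : b ≤ H) {n n' : Multiset Seg}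
    (h : Hat H a b n n') (hlo : ¬ ∃ r ∈ n, r.1 ≤ a + 1) {T z : ℤ} {M : Multiset Seg} {T' z' : ℤ}
    {M' : Multiset Seg} (hP : Phi b n T z M) (hP' : Phi b n' T' z' M') :
    RedC H a b n n' T z M T' z' M' := by
  push Not at hlo
  have n0 := col_hi (H := H) (n := n) (s := a) (fun r hr => by have := hlo r hr; omega)
  have n1 := col_hi (H := H) (n := n) (s := a + 1) (fun r hr => hlo r hr)
  have n1' : ∀ t, col H n' (a + 1) t = 0 := by
    intro t
    rw [h.f]; unfold ff; rw [uu_zero (n0 t), n1]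
  obtain rfl : n = n' := by
    ext ⟨s, e⟩
    by_cases hs : a + 2 ≤ s
    · exact h.hi s e hs
    · rw [Multiset.count_eq_zero.2, Multiset.count_eq_zero.2]
      · intro hm
        have h1 := h.rng' _ hm
        simp only at h1
        obtain rfl : s = a + 1 := by omega
        obtain ⟨t, rfl⟩ := idx h1.2.2.2
        have := n1' t
        rw [mem_col] at hm
        omega
      · intro hm
        have h1 := hlo _ hm
        simp only at h1
        omega
  obtain ⟨rfl, rfl, rfl⟩ := hP.unique hP'
  refine ⟨fun _ _ _ => rfl, ?_⟩
  rcases (by omega : a = b ∨ a + 2 ≤ b + 1) with rfl | hlt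
  · obtain rfl : n = 0 := by
      rw [Multiset.eq_zero_iff_forall_notMem]
      intro r hr
      have h1 := hlo r hr
      have h2 := h.rng r hr
      omega
    obtain ⟨rfl, rfl, rfl⟩ := hP.unique Phi.zero
    obtain ⟨x, hx⟩ := idx hH
    have hV : ∀ t, Vt H z z t = dl x t := by
      intro t
      unfold Vt
      rw [if_pos rfl, show (H - z).toNat = x by omega]
    refine Or.inr ⟨x, ⟨rfl, hx, fun t => ?_⟩, Or.inl ⟨rfl, hx, fun t _ => uu_zero ?_,
      fun t => rfl, fun t => ?_⟩⟩
    · rw [hV]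
    · exact n0 t
    · rw [hV]
  · obtain ⟨h1, h2⟩ := hP.ge hlt (fun r hr => by have := hlo r hr; omega)
    have m0 := col_hi (H := H) (n := M) (s := a) (fun r hr => by have := h2 r hr; omega)
    have m1 := col_hi (H := H) (n := M) (s := a + 1) (fun r hr => by have := h2 r hr; omega)
    refine Or.inl ⟨by omega, rfl, rfl, fun t => ?_, fun t => ?_, fun t => ?_⟩
    · rw [m0, n0]
    · rw [m1, n1]
    · rw [m1, n1]

lemma red {H a b : ℤ} (hab : a ≤ b) (hH : b ≤ H) : ∀ (k : ℕ) {n n' : Multiset Seg}, n.card ≤ k →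
    Hat H a b n n' → ∀ {T z : ℤ} {M : Multiset Seg} {T' z' : ℤ} {M' : Multiset Seg},
    Phi b n T z M → Phi b n' T' z' M' → RedC H a b n n' T z M T' z' M' := by
  intro k
  induction k with
  | zero =>
    intro n n' hk h T z M T' z' M' hP hP'
    obtain rfl : n = 0 := by simpa using hk
    exact red_base hab hH h (by simp) hP hP'
  | succ k ih =>
    intro n n' hk h T z M T' z' M' hP hP'
    by_cases hlo : ∃ r ∈ n, r.1 ≤ a + 1
    · cases hP with
      | zero => simp at hlo
      | step _ R T1 z1 M1 D _ _ hR hP1 hD hz hM =>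
        obtain ⟨tail, t0, htail, hR', hHat, hcase⟩ := row_cmp hab h hR hlo
        cases hP' with
        | zero => exact absurd rfl hR'.ne
        | step _ R' T1' z1' M1' D' _ _ hR'2 hP1' hD' hz' hM' =>
          obtain rfl := hR'.unique hR'2
          obtain ⟨hhi, hrec⟩ := ih (by have := hR.card; omega) hHat hP1 hP1'
          have cs := col_step hR.le hM H
          have cs' := col_step hR'.le hM' H
          have ct := count_step hR.le hM
          have ct' := count_step hR'.le hM'
          have hpw := hR.pw
          -- comparison of high columns
          have hhi2 : (∀ s e, a + 2 ≤ s → ((D = (s, e) ↔ D' = (s, e)) ∧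
              ((T1, D.2) = (s, e) ↔ (T1', D'.2) = (s, e)))) →
              ∀ s e, a + 2 ≤ s → M.count (s, e) = M'.count (s, e) := by
            intro hh s e hs
            have h1 := ct (s, e)
            have h2 := ct' (s, e)
            have h3 := h.hi s e hs
            have h4 := hHat.hi s e hs
            have h5 := hhi s e hs
            have h6 := hh s e hs
            simp only [h6.1, h6.2] at h1
            omega
          rcases hrec with hA | ⟨x, hB, hB12⟩
          · -- state A
            obtain ⟨hT', rfl, rfl, a0, a1, a'⟩ := hA
            have hT1 := hP1.le
            have hV : ∀ t, Vt H a b t = 0 := by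
              intro t; unfold Vt; rw [if_neg]; omega
            rcases List.mem_cons.1 hD'.1 with hDh | hDt
            · -- head picked
              subst hDh
              have htl : ∀ r ∈ tail, T1 < r.1 := by
                intro r hr
                by_contra hh
                have h1 := hD'.2.2 r (by simp [hr]) (by omega)
                have h2 := htail r hr
                simp at h1
                omega
              have e1 : z' = H - (t0 : ℤ) := by
                rw [hz', if_neg]
                simp; omega
              have hB' : RedB H a b n n' (a + 1) z' M' t0 := by
                refine ⟨rfl, e1, fun t => ?_⟩
                have h1 := cs' (a + 1) t
                have h2 := a' t
                rw [ci_eq, ci_ne (by simp; omega)] at h1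
                rw [hV]
                omega
              rcases hcase with ⟨hRe, hu, hc0⟩ | hc23
              · have hDp : Pick R T1 (a, H - (t0 : ℤ)) := by
                  rw [hRe]
                  refine ⟨by simp, by simp; omega, fun r hr hrT => ?_⟩
                  rcases List.mem_cons.1 hr with rfl | hr
                  · exact le_rfl
                  · have := htl r hr; omega
                obtain rfl := hD.unique hpw hDp
                refine ⟨hhi2 fun s e hs => ?_, Or.inr ⟨t0, hB', Or.inr ⟨t0, ?_⟩⟩⟩
                · simp
                  intros
                  omega
                · refine ⟨rfl, ?_, ⟨?_, le_rfl, fun t h1 h2 => by omega⟩, fun t => ?_, fun t => ?_⟩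
                  · rw [hz, if_neg]; simp; omega
                  · rw [hu, dl_self]; omega
                  · have h1 := cs a t
                    have h2 := a0 t
                    rw [ci_eq, ci_ne (by simp; omega)] at h1
                    omega
                  · have h1 := cs (a + 1) t
                    have h2 := a1 t
                    rw [ci_ne (by simp), ci_ne (by simp; omega)] at h1
                    rw [hV]
                    omega
              · have hRsub : (a + 1, H - (t0 : ℤ)) ∈ R ∧ (∀ r ∈ R, r.1 ≤ a + 1 ∨ r ∈ tail) ∧
                    (∀ t ≤ t0, U H a n t = 0) := by
                  rcases hc23 with ⟨rfl, hc0⟩ | ⟨t00, hlt, rfl, hu, hc0⟩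
                  · refine ⟨by simp, fun r hr => ?_, fun t _ => uu_zero (hc0 t)⟩
                    rcases List.mem_cons.1 hr with rfl | hr
                    · left; simp
                    · right; exact hr
                  · refine ⟨by simp, fun r hr => ?_, fun t ht => uu_zero ?_⟩
                    · rcases List.mem_cons.1 hr with rfl | hr
                      · left; simp
                      · rcases List.mem_cons.1 hr with rfl | hr
                        · left; simp
                        · right; exact hr
                    · by_contra hh
                      have := hc0 t (by omega)
                      omega
                have hDp : Pick R T1 (a + 1, H - (t0 : ℤ)) := by
                  refine ⟨hRsub.1, by simp; omega, fun r hr hrT => ?_⟩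
                  rcases hRsub.2.1 r hr with h1 | h1
                  · exact h1
                  · have := htl r h1; omega
                obtain rfl := hD.unique hpw hDp
                refine ⟨hhi2 fun s e hs => ?_, Or.inr ⟨t0, hB', Or.inl ?_⟩⟩
                · simp
                · refine ⟨rfl, ?_, hRsub.2.2, fun t => ?_, fun t => ?_⟩
                  · rw [hz, if_neg]; simp; omega
                  · have h1 := cs a t
                    have h2 := a0 t
                    rw [ci_ne (by simp), ci_ne (by simp; omega)] at h1
                    omega
                  · have h1 := cs (a + 1) t
                    have h2 := a1 t
                    rw [ci_eq, ci_ne (by simp; omega)] at h1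
                    rw [hV]
                    omega
            · -- tail picked
              have hD2 := htail _ hDt
              have hRsub : (∀ r ∈ R, r.1 ≤ a + 1 ∨ r ∈ tail) ∧ ∀ r ∈ tail, r ∈ R := by
                rcases hcase with ⟨rfl, -⟩ | ⟨rfl, -⟩ | ⟨t00, hlt, rfl, -⟩
                · constructor
                  · intro r hr
                    rcases List.mem_cons.1 hr with rfl | hr
                    · left; simp
                    · right; exact hr
                  · intro r hr; simp [hr]
                · constructor
                  · intro r hr
                    rcases List.mem_cons.1 hr with rfl | hr
                    · left; simp
                    · right; exact hr
                  · intro r hr; simp [hr]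
                · constructor
                  · intro r hr
                    rcases List.mem_cons.1 hr with rfl | hr
                    · left; simp
                    · rcases List.mem_cons.1 hr with rfl | hr
                      · left; simp
                      · right; exact hr
                  · intro r hr; simp [hr]
              have hDp : Pick R T1 D' := by
                refine ⟨hRsub.2 _ hDt, hD'.2.1, fun r hr hrT => ?_⟩
                rcases hRsub.1 r hr with h1 | h1
                · omega
                · exact hD'.2.2 r (by simp [h1]) hrT
              obtain rfl := hD.unique hpw hDp
              refine ⟨hhi2 fun s e hs => ?_, Or.inl ⟨by omega, rfl, by rw [hz, hz'],
                fun t => ?_, fun t => ?_, fun t => ?_⟩⟩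
              · simp
              · have h1 := cs a t
                have h2 := a0 t
                rw [ci_ne (by omega), ci_ne (by simp; omega)] at h1
                omega
              · have h1 := cs (a + 1) t
                have h2 := a1 t
                rw [ci_ne (by omega), ci_ne (by simp; omega)] at h1
                omega
              · have h1 := cs' (a + 1) t
                have h2 := a' t
                rw [ci_ne (by omega), ci_ne (by simp; omega)] at h1
                omega
          · -- state B
            obtain ⟨rfl, b2, b'⟩ := hB
            have hDh : D' = (a + 1, H - (t0 : ℤ)) := by
              rcases List.mem_cons.1 hD'.1 with hDh | hDt
              · exact hDh
              · have := htail _ hDt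
                have := hD'.2.1
                omega
            subst hDh
            have hB' : RedB H a b n n' (a + 1) z' M' x := by
              refine ⟨rfl, ?_, fun t => ?_⟩
              · rw [hz', if_pos rfl, b2]
              · have h1 := cs' (a + 1) t
                have h2 := b' t
                rw [ci_eq] at h1
                omega
            have hle : t0 ≤ x := by
              have h1 := hB'.c' x
              rw [dl_self] at h1
              by_cases hx : 0 < col H n' (a + 1) x
              · rw [← mem_col] at hx
                obtain ⟨p, l, hpl, -, hp2, -⟩ := hR'
                simp at hpl
                have := (hp2 _ hx).2 (by rw [← hpl.1])
                rw [← hpl.1] at this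
                simp at this
                omega
              · have h2 : 0 < Vt H a b x := by omega
                unfold Vt dl at h2
                have := (h.rng' _ (hR'.mem _ (List.mem_cons_self ..))).2.2.1
                simp at this
                split_ifs at h2 <;> omega
            rcases hB12 with hB2 | ⟨y, hB1⟩
            · obtain ⟨rfl, d2, d3, d4, d5⟩ := hB2
              rcases hcase with ⟨hRe, hu, hc0⟩ | hc23
              · have hDp : Pick R (a + 1) (a, H - (t0 : ℤ)) := by
                  rw [hRe]
                  refine ⟨by simp, by simp, fun r hr hrT => ?_⟩
                  rcases List.mem_cons.1 hr with rfl | hr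
                  · exact le_rfl
                  · have := htail r hr; omega
                obtain rfl := hD.unique hpw hDp
                refine ⟨hhi2 fun s e hs => ?_, Or.inr ⟨x, hB', Or.inr ⟨t0, ?_⟩⟩⟩
                · simp
                  intros
                  omega
                · refine ⟨rfl, ?_, ⟨?_, hle, fun t h1 h2 => ?_⟩, fun t => ?_, fun t => ?_⟩
                  · rw [hz, if_neg]; simp
                  · rw [hu, dl_self]; omega
                  · rw [hu, d3 t h2, dl_ne (by omega)]
                  · have h1 := cs a t
                    have h2 := d4 t
                    rw [ci_eq, ci_ne (by simp)] at h1
                    omega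
                  · have h1 := cs (a + 1) t
                    have h2 := d5 t
                    rw [ci_ne (by simp), ci_eq] at h1
                    omega
              · have hRsub : (a + 1, H - (t0 : ℤ)) ∈ R ∧ (∀ r ∈ R, r.1 ≤ a + 1 ∨ r ∈ tail) ∧
                    (∀ t ≤ x, U H a n t = 0) := by
                  rcases hc23 with ⟨rfl, hc0⟩ | ⟨t00, hlt, rfl, hu, hc0⟩
                  · refine ⟨by simp, fun r hr => ?_, fun t _ => uu_zero (hc0 t)⟩
                    rcases List.mem_cons.1 hr with rfl | hr
                    · left; simp
                    · right; exact hr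
                  · refine ⟨by simp, fun r hr => ?_, fun t ht => ?_⟩
                    · rcases List.mem_cons.1 hr with rfl | hr
                      · left; simp
                      · rcases List.mem_cons.1 hr with rfl | hr
                        · left; simp
                        · right; exact hr
                    · rw [hu, d3 t ht]
                have hDp : Pick R (a + 1) (a + 1, H - (t0 : ℤ)) := by
                  refine ⟨hRsub.1, by simp, fun r hr hrT => ?_⟩
                  exact hrT
                obtain rfl := hD.unique hpw hDp
                refine ⟨hhi2 fun s e hs => ?_, Or.inr ⟨x, hB', Or.inl ?_⟩⟩
                · simp
                · refine ⟨rfl, ?_, hRsub.2.2, fun t => ?_, fun t => ?_⟩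
                  · rw [hz, if_pos rfl, d2]
                  · have h1 := cs a t
                    have h2 := d4 t
                    rw [ci_ne (by simp)] at h1
                    omega
                  · have h1 := cs (a + 1) t
                    have h2 := d5 t
                    rw [ci_eq] at h1
                    omega
            · obtain ⟨rfl, d2, d3, d4, d5⟩ := hB1
              have hypos : 0 < col H n T1 y := by
                have h1 := d3.1
                unfold U uu at h1
                have h2 := col_sub H n (R : Multiset Seg) T1 y
                omega
              have hex : ∃ t00 : ℕ, (T1, H - (t00 : ℤ)) ∈ R ∧ IsLast (U H T1 n) x y := by
                rcases hcase with ⟨rfl, hu, hc0⟩ | ⟨rfl, hc0⟩ | ⟨t00, hlt, rfl, hu, hc0⟩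
                · refine ⟨t0, by simp, ?_, d3.2.1, fun t h1 h2 => ?_⟩
                  · have := d3.1
                    rw [hu]; omega
                  · have := hc0 y hypos
                    rw [hu, d3.2.2 t h1 h2, dl_ne (by omega)]
                · have := hc0 y; omega
                · refine ⟨t00, by simp, ?_, d3.2.1, fun t h1 h2 => ?_⟩
                  · rw [hu]; exact d3.1
                  · rw [hu]; exact d3.2.2 t h1 h2
              obtain ⟨t00, hmem, hlast⟩ := hex
              have hDp : Pick R T1 (T1, H - (t00 : ℤ)) := ⟨hmem, le_rfl, fun r hr hrT => hrT⟩
              obtain rfl := hD.unique hpw hDp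
              refine ⟨hhi2 fun s e hs => ?_, Or.inr ⟨x, hB', Or.inr ⟨y, ?_⟩⟩⟩
              · simp only [Prod.mk.injEq]
                constructor <;> constructor <;> intros <;> omega
              · refine ⟨rfl, ?_, hlast, fun t => ?_, fun t => ?_⟩
                · rw [hz, if_pos rfl, d2]
                · have h1 := cs T1 t
                  dsimp only at h1
                  have h2 := d4 t
                  omega
                · have h1 := cs (T1 + 1) t
                  dsimp only at h1
                  have h2 := d5 t
                  omega
    · exact red_base hab hH h hlo hP hP'

lemma uu_unm {e c : ℕ → ℕ} (h : ∀ s t, s < t → 0 < c s → e t = 0) (t : ℕ) : uu e c t = e t := by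
  by_cases h0 : e t = 0
  · rw [uu_zero h0, h0]
  · have hc : ∀ s, s < t → c s = 0 := by
      intro s hs
      by_contra hne
      exact h0 (h s t hs (Nat.pos_of_ne_zero hne))
    have hQ : ∀ r, r ≤ t → Qw e c r = 0 := by
      intro r
      induction r with
      | zero => intro _; rfl
      | succ r ih =>
        intro hr
        have := hc r (by omega)
        have := ih (by omega)
        simp only [Qw]
        omega
    unfold uu
    rw [hQ t le_rfl]
    omega

lemma mem_snd {n : Multiset Seg} {i y : ℤ} : y ∈ (startAt n i).map Prod.snd ↔ (i, y) ∈ n := by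
  simp [startAt]

lemma col_erase (H : ℤ) (n : Multiset Seg) (s : ℤ) (t0 t : ℕ) (h : (s, H - (t0 : ℤ)) ∈ n) :
    col H (n.erase (s, H - (t0 : ℤ))) s t + dl t0 t = col H n s t := by
  unfold col dl
  split_ifs with h1
  · subst h1
    rw [Multiset.count_erase_self]
    have := Multiset.count_pos.2 h
    omega
  · rw [Multiset.count_erase_of_ne]
    · rfl
    · intro h2
      simp only [Prod.mk.injEq, true_and] at h2
      omega

lemma count_erase_other {n : Multiset Seg} {s s' e e' : ℤ} (h : s ≠ s') :
    (n.erase (s', e')).count (s, e) = n.count (s, e) := by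
  rw [Multiset.count_erase_of_ne]
  intro h2
  exact h (by simpa using congrArg Prod.fst h2)

lemma tds_some {H c : ℤ} {n n' : Multiset Seg} (hn : IsMS n) (hH : ∀ r ∈ n, r.2 ≤ H)
    (h : tdsStep n c = some n') : n' ≤ n ∧ n'.card + 2 = n.card ∧
    ∀ t, uu (col H n' c) (col H n' (c + 1)) t = uu (col H n c) (col H n (c + 1)) t := by
  unfold tdsStep at h
  cases h1 : longStart n (c + 1) with
  | none => simp [h1] at h
  | some D =>
    rw [h1] at h
    simp only at h
    unfold longStart at h1
    simp only [Option.map_eq_some_iff] at h1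
    obtain ⟨e1, h1, rfl⟩ := h1
    rw [msetMax_some] at h1
    obtain ⟨h1, h1m⟩ := h1
    rw [mem_snd] at h1
    cases h2 : msetMax (((startAt n c).filter fun D => Prec D (c + 1, e1)).map Prod.snd) with
    | none => rw [h2] at h; simp at h
    | some y =>
      rw [h2] at h
      simp only [Option.some.injEq] at h
      rw [msetMax_some] at h2
      obtain ⟨h2, h2m⟩ := h2
      have hy : (c, y) ∈ n ∧ y < e1 := by
        simp only [startAt, Multiset.mem_map, Multiset.mem_filter] at h2
        obtain ⟨⟨p, q⟩, h3, h4⟩ := h2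
        simp only at h3 h4
        obtain ⟨⟨h5, h6⟩, h7, h8, h9⟩ := h3
        subst h4 h6
        exact ⟨h5, h8⟩
      obtain ⟨hy, hy1⟩ := hy
      have hmax : ∀ e, (c, e) ∈ n → e < e1 → e ≤ y := by
        intro e he hee
        apply h2m
        simp only [startAt, Multiset.mem_map, Multiset.mem_filter]
        have := hn _ he
        simp only at this
        exact ⟨(c, e), ⟨⟨he, rfl⟩, by simp, hee, by simp; omega⟩, rfl⟩
      obtain ⟨t1, rfl⟩ := idx (hH _ h1)
      obtain ⟨t0, rfl⟩ := idx (hH _ hy)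
      have hmem : (c + 1, H - (t1 : ℤ)) ∈ n.erase (c, H - (t0 : ℤ)) := by
        rw [Multiset.mem_erase_of_ne]
        · exact h1
        · simp
      subst h
      refine ⟨(Multiset.erase_le _ _).trans (Multiset.erase_le _ _), ?_, ?_⟩
      · rw [Multiset.card_erase_of_mem hmem, Multiset.card_erase_of_mem hy]
        have h3 := Multiset.card_pos_iff_exists_mem.2 ⟨_, hmem⟩
        rw [Multiset.card_erase_of_mem hy] at h3
        simp only [Nat.pred_eq_sub_one] at *
        omega
      · apply uu_pair (t0 := t0) (t1 := t1) (by omega)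
        · intro t
          have := col_erase H n c t0 t hy
          unfold col at this ⊢
          rw [count_erase_other (by omega)]
          exact this
        · intro t
          have := col_erase H (n.erase (c, H - (t0 : ℤ))) (c + 1) t1 t hmem
          rw [this]
          unfold col
          rw [count_erase_other (by omega)]
        · intro t ht ht'
          by_contra hne
          have := hmax (H - (t : ℤ)) (mem_col.2 (Nat.pos_of_ne_zero hne)) (by omega)
          omega

lemma tds_none {H c : ℤ} {n : Multiset Seg} (hn : IsMS n) 
    (h : tdsStep n c = none) (t : ℕ) :
    uu (col H n c) (col H n (c + 1)) t = col H n c t := by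
  apply uu_unm
  intro s t hst hs
  by_contra hne
  have h0 := mem_col.2 (Nat.pos_of_ne_zero hne)
  have hs := mem_col.2 hs
  unfold tdsStep at h
  cases h1 : longStart n (c + 1) with
  | none =>
    unfold longStart at h1
    rw [Option.map_eq_none_iff, msetMax_none] at h1
    have := mem_snd.2 hs
    rw [h1] at this
    simp at this
  | some D =>
    rw [h1] at h
    simp only at h
    unfold longStart at h1
    simp only [Option.map_eq_some_iff] at h1
    obtain ⟨e1, h1, rfl⟩ := h1
    rw [msetMax_some] at h1
    obtain ⟨h1, h1m⟩ := h1
    have hle := h1m _ (mem_snd.2 hs)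
    cases h2 : msetMax (((startAt n c).filter fun D => Prec D (c + 1, e1)).map Prod.snd) with
    | some y => rw [h2] at h; simp at h
    | none =>
      rw [msetMax_none] at h2
      have : H - (t : ℤ) ∈ ((startAt n c).filter fun D => Prec D (c + 1, e1)).map Prod.snd := by
        simp only [startAt, Multiset.mem_map, Multiset.mem_filter]
        have := hn _ h0
        simp only at this
        exact ⟨(c, H - (t : ℤ)), ⟨⟨h0, rfl⟩, by simp, by simp; omega, by simp; omega⟩, rfl⟩
      rw [h2] at this
      simp at this

lemma tdsIterF_col {H c : ℤ} : ∀ (k : ℕ) (n : Multiset Seg), n.card ≤ k → IsMS n →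
    (∀ r ∈ n, r.2 ≤ H) → tdsIterF c k n ≤ n ∧
    ∀ t, col H (tdsIterF c k n) c t = uu (col H n c) (col H n (c + 1)) t := by
  intro k
  induction k with
  | zero =>
    intro n hk hn hH
    have : n = 0 := by simpa using hk
    subst this
    refine ⟨le_rfl, fun t => ?_⟩
    rw [uu_zero (by simp [col])]
    simp [col, tdsIterF]
  | succ k ih =>
    intro n hk hn hH
    unfold tdsIterF
    cases h : tdsStep n c with
    | none => exact ⟨le_rfl, fun t => (tds_none hn h t).symm⟩
    | some n' =>
      obtain ⟨h1, h2, h3⟩ := tds_some hn hH h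
      obtain ⟨h4, h5⟩ := ih n' (by omega) (fun r hr => hn r (Multiset.mem_of_le h1 hr))
        (fun r hr => hH r (Multiset.mem_of_le h1 hr))
      exact ⟨h4.trans h1, fun t => by rw [h5, h3]⟩

lemma Drho_iff {H c : ℤ} {m : Multiset Seg} (hm : IsMS m) (hH : ∀ r ∈ m, r.2 ≤ H)
    (X : Multiset Seg) : Drho c m = some X ↔ ∃ d, 0 < uu (col H m c) (col H m (c + 1)) d ∧
      (∀ t, d < t → uu (col H m c) (col H m (c + 1)) t = 0) ∧
      X = pushSeg (m.erase (c, H - (d : ℤ))) (c + 1) (H - d) := by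
  obtain ⟨h1, h2⟩ := tdsIterF_col (H := H) (c := c) m.card m le_rfl hm hH
  unfold Drho tdsIter shortStart
  simp only [Option.map_eq_some_iff]
  simp only [← h2, ← mem_col]
  set n := tdsIterF c m.card m
  constructor
  · rintro ⟨p, ⟨e, he, rfl⟩, rfl⟩
    rw [msetMin_some] at he
    obtain ⟨he, he'⟩ := he
    rw [mem_snd] at he
    obtain ⟨d, rfl⟩ := idx (hH _ (Multiset.mem_of_le h1 he))
    refine ⟨d, he, fun t ht => ?_, rfl⟩
    by_contra hne
    have := he' _ (mem_snd.2 (mem_col.2 (Nat.pos_of_ne_zero hne)))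
    omega
  · rintro ⟨d, hd, hd', rfl⟩
    refine ⟨(c, H - (d : ℤ)), ⟨_, ?_, rfl⟩, rfl⟩
    rw [msetMin_some]
    refine ⟨mem_snd.2 hd, fun y hy => ?_⟩
    rw [mem_snd] at hy
    obtain ⟨t, rfl⟩ := idx (hH _ (Multiset.mem_of_le h1 hy))
    by_contra hne
    have := hd' t (by omega)
    have := mem_col.1 hy
    omega

lemma exists_col (H s : ℤ) (f : ℕ → ℕ) : ∀ L : ℕ, ∃ S : Multiset Seg,
    (∀ r ∈ S, ∃ t : ℕ, t < L ∧ r = (s, H - (t : ℤ))) ∧ ∀ t, t < L → col H S s t = f t := by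
  intro L
  induction L with
  | zero => exact ⟨0, by simp, by simp⟩
  | succ L ih =>
    obtain ⟨S, h1, h2⟩ := ih
    refine ⟨S + Multiset.replicate (f L) (s, H - (L : ℤ)), ?_, ?_⟩
    · intro r hr
      rw [Multiset.mem_add] at hr
      rcases hr with hr | hr
      · obtain ⟨t, h3, h4⟩ := h1 r hr
        exact ⟨t, by omega, h4⟩
      · exact ⟨L, by omega, Multiset.eq_of_mem_replicate hr⟩
    · intro t ht
      unfold col at h2 ⊢
      rw [Multiset.count_add, Multiset.count_replicate]
      by_cases h : t = L
      · subst h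
        rw [Multiset.count_eq_zero_of_notMem]
        · simp
        · intro h3
          obtain ⟨t', h4, h5⟩ := h1 _ h3
          simp only [Prod.mk.injEq, true_and] at h5
          omega
      · rw [h2 t (by omega), if_neg]
        · rfl
        · intro h5
          simp only [Prod.mk.injEq, true_and] at h5
          omega

lemma exists_Hat {H a b : ℤ} (hab : a ≤ b) {n : Multiset Seg}
    (rng : ∀ r ∈ n, a ≤ r.1 ∧ r.1 ≤ b + 1 ∧ b ≤ r.2 ∧ r.2 ≤ H) : ∃ n', Hat H a b n n' := by
  obtain ⟨S, h1, h2⟩ := exists_col H (a + 1) (ff (col H n a) (col H n (a + 1))) ((H + 1 - b).toNat)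
  refine ⟨n.filter (fun r => a + 2 ≤ r.1) + S, rng, ?_, ?_, ?_⟩
  · intro r hr
    rw [Multiset.mem_add, Multiset.mem_filter] at hr
    rcases hr with ⟨hr, hr'⟩ | hr
    · have := rng r hr
      omega
    · obtain ⟨t, h3, rfl⟩ := h1 r hr
      simp only
      omega
  · intro s e hs
    rw [Multiset.count_add, Multiset.count_filter_of_pos (by simpa using hs),
      Multiset.count_eq_zero_of_notMem (s := S)]
    · rfl
    · intro hr
      obtain ⟨t, h3, h4⟩ := h1 _ hr
      simp only [Prod.mk.injEq] at h4
      omega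
  · intro t
    have h0 : col H (n.filter (fun r => a + 2 ≤ r.1)) (a + 1) t = 0 := by
      apply Multiset.count_eq_zero_of_notMem
      intro h
      have := (Multiset.mem_filter.1 h).2
      simp only at this
      omega
    have hadd : col H (n.filter (fun r => a + 2 ≤ r.1) + S) (a + 1) t = col H S (a + 1) t := by
      unfold col at h0 ⊢
      rw [Multiset.count_add, h0]
      omega
    rw [hadd]
    by_cases ht : t < (H + 1 - b).toNat
    · exact h2 t ht
    · have hz : ∀ s, col H n s t = 0 := by
        intro s
        apply Multiset.count_eq_zero_of_notMem
        intro h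
        have := rng _ h
        simp only at this
        omega
      have hS : col H S (a + 1) t = 0 := by
        apply Multiset.count_eq_zero_of_notMem
        intro h
        obtain ⟨t', h3, h4⟩ := h1 _ h
        simp only [Prod.mk.injEq, true_and] at h4
        omega
      unfold ff
      rw [uu_zero (hz a), hz, hS]

lemma Phi.triv {b : ℤ} {n : Multiset Seg} {T z : ℤ} {M : Multiset Seg} (h : Phi b n T z M)
    (hn : ∀ r ∈ n, r.1 = b + 1) : T = b + 1 ∧ z = b ∧ M = n := by
  induction h with
  | zero => simp
  | step n R T z M D z1 M1 hR hP hD hz hM ih =>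
    obtain ⟨h1, h2, h3⟩ := ih (fun r hr => hn r (Multiset.mem_of_le (Multiset.sub_le_self _ _) hr))
    have hD1 := hn _ (hR.mem _ hD.1)
    refine ⟨hD1, ?_, ?_⟩
    · rw [hz, if_pos (by omega), h2]
    · rw [h3, tsub_add_cancel_of_le hR.le, h1, ← hD1] at hM
      exact add_right_cancel hM

lemma Phi.M_le {b H : ℤ} {n : Multiset Seg} {T z : ℤ} {M : Multiset Seg} (h : Phi b n T z M)
    (hn : ∀ r ∈ n, r.2 ≤ H) : ∀ r ∈ M, r.2 ≤ H := by
  induction h with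
  | zero => simp
  | step n R T z M D z1 M1 hR hP hD hz hM ih =>
    have ih := ih (fun r hr => hn r (Multiset.mem_of_le (Multiset.sub_le_self _ _) hr))
    intro r hr
    have : r ∈ M + (R : Multiset Seg) + {(T, D.2)} := by
      rw [← hM]; simp [hr]
    simp only [Multiset.mem_add, Multiset.mem_singleton, Multiset.mem_coe] at this
    rcases this with (h | h) | h
    · exact ih r h
    · exact hn _ (hR.mem _ h)
    · have h4 := hn _ (hR.mem _ hD.1)
      rw [h]; exact h4

lemma uu_clip {e c e' c' : ℕ → ℕ} {L : ℕ} (he : ∀ t ≤ L, e t = e' t) (hc : ∀ t ≤ L, c t = c' t) :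
    ∀ t ≤ L, uu e c t = uu e' c' t := by
  intro t ht
  unfold uu
  rw [he t ht, Qw_congr t (fun s hs => ⟨he s (by omega), hc s (by omega)⟩)]

lemma ff_clip {e c e' c' : ℕ → ℕ} {L : ℕ} (he : ∀ t ≤ L, e t = e' t) (hc : ∀ t ≤ L, c t = c' t) :
    ∀ t ≤ L, ff e c t = ff e' c' t := by
  intro t ht
  unfold ff
  rw [uu_clip he hc t ht, hc t ht]

lemma IsLast.clip {u u' : ℕ → ℕ} {L x y : ℕ} (h : ∀ t ≤ L, u t = u' t) (hx : x ≤ L)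
    (hy : IsLast u x y) : IsLast u' x y := by
  obtain ⟨h1, h2, h3⟩ := hy
  exact ⟨by rw [← h y (by omega)]; exact h1, h2,
    fun t ht ht' => by rw [← h t (by omega)]; exact h3 t ht ht'⟩

/-- the shape of the outcome of the Langlands derivative -/
structure Res (H a : ℤ) (m n2 M2 X : Multiset Seg) (x y y' : ℕ) : Prop where
  c0 : ∀ t, col H X a t + dl y' t = col H m a t
  c1 : ∀ t, col H X (a + 1) t + dl y t = col H m (a + 1) t + dl y' t
  c2 : ∀ t, t < (H - (a + 1)).toNat → col H X (a + 1 + 1) t + dl x t =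
    col H m (a + 1 + 1) t + dl y t
  lo : ∀ s e, s < a → X.count (s, e) = m.count (s, e)
  hi : ∀ s e, a + 3 ≤ s → s ≤ e → X.count (s, e) + n2.count (s, e) =
    m.count (s, e) + M2.count (s, e)
  ms : IsMS X
  le : ∀ r ∈ X, r.2 ≤ H

lemma mRange_rng {H a b : ℤ} {m : Multiset Seg} (hH : ∀ r ∈ m, r.2 ≤ H) :
    ∀ r ∈ mRange m a b, a ≤ r.1 ∧ r.1 ≤ b + 1 ∧ b ≤ r.2 ∧ r.2 ≤ H := by
  intro r hr
  obtain ⟨h1, h2⟩ := Multiset.mem_filter.1 hr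
  exact ⟨h2.1, h2.2.1, h2.2.2, hH r h1⟩

lemma mRange_col {H a b s : ℤ} {m : Multiset Seg} (h1 : a ≤ s) (h2 : s ≤ b + 1) (hb : b ≤ H) :
    ∀ t ≤ (H - b).toNat, col H (mRange m a b) s t = col H m s t := by
  intro t ht
  unfold col mRange
  rw [Multiset.count_filter_of_pos]
  exact ⟨h1, h2, by simp only; omega⟩

lemma DLang_res {H a b : ℤ} (hab : a < b) (hb : b ≤ H) {m : Multiset Seg} (hm : IsMS m)
    (hH : ∀ r ∈ m, r.2 ≤ H) {n1 n2 : Multiset Seg} (h1 : Hat H a b (mRange m a b) n1)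
    (h2 : Hat H (a + 1) b n1 n2) {T2 z2 : ℤ} {M2 : Multiset Seg} (hP2 : Phi b n2 T2 z2 M2) :
    (∀ X, DLang a b m = some X → ∃ x y y' : ℕ, T2 = a + 2 ∧ z2 = H - x ∧
      IsLast (uu (ff (col H m a) (col H m (a + 1))) (col H m (a + 1 + 1))) x y ∧
      IsLast (uu (col H m a) (col H m (a + 1))) y y' ∧ Res H a m n2 M2 X x y y') ∧
    (∀ x y y' : ℕ, T2 = a + 2 → z2 = H - x →
      IsLast (uu (ff (col H m a) (col H m (a + 1))) (col H m (a + 1 + 1))) x y →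
      IsLast (uu (col H m a) (col H m (a + 1))) y y' → DLang a b m ≠ none) := by
  obtain ⟨T, z, M, hP⟩ := exists_Phi b _ (mRange m a b) le_rfl (fun r hr => (h1.rng r hr).2.1)
  obtain ⟨T1, z1, M1, hP1⟩ := exists_Phi b _ n1 le_rfl (fun r hr => (h2.rng r hr).2.1)
  have r1 := red (by omega) hb _ le_rfl h1 hP hP1
  have r2 := red (by omega) hb _ le_rfl h2 hP1 hP2
  have hz2 := hP2.z_le hb (fun r hr => (h2.rng' r hr).2.2)
  have k0 := mRange_col (H := H) (a := a) (b := b) (s := a) (m := m) (by omega) (by omega) hb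
  have k1 := mRange_col (H := H) (a := a) (b := b) (s := a + 1) (m := m) (by omega) (by omega) hb
  have k2 := mRange_col (H := H) (a := a) (b := b) (s := a + 1 + 1) (m := m) (by omega)
    (by omega) hb
  have q2 : ∀ t, col H n1 (a + 1 + 1) t = col H (mRange m a b) (a + 1 + 1) t := by
    intro t
    exact (h1.hi _ _ (by omega)).symm
  have u1 : ∀ t ≤ (H - b).toNat, U H a (mRange m a b) t = uu (col H m a) (col H m (a + 1)) t :=
    uu_clip k0 k1
  have u2 : ∀ t ≤ (H - b).toNat, U H (a + 1) n1 t =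
      uu (ff (col H m a) (col H m (a + 1))) (col H m (a + 1 + 1)) t := by
    apply uu_clip
    · intro t ht
      rw [h1.f, ff_clip k0 k1 t ht]
    · intro t ht
      rw [q2, k2 t ht]
  have v1 : ∀ t, Vt H a b t = 0 := by
    intro t
    unfold Vt
    rw [if_neg (by omega)]
  constructor
  · intro X hX
    rw [DLang_iff hm hab hP] at hX
    obtain ⟨hT, hX⟩ := hX
    obtain ⟨e1, r1⟩ := r1
    rcases r1 with r1 | ⟨x1, rB, r1 | ⟨y', r1⟩⟩
    · have := r1.hT'
      have := r1.hT
      omega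
    · have := r1.hT
      omega
    obtain ⟨e2, r2⟩ := r2
    have hT1 := rB.hT'
    rcases r2 with r2 | ⟨x, rB2, r2 | ⟨y, r2⟩⟩
    · have := r2.hT'
      have := r2.hT
      omega
    · have := r2.hT
      omega
    have hxy : x1 = y := by
      have := rB.hz'
      have := r2.hz
      omega
    subst hxy
    have hx : x ≤ (H - b).toNat := by
      have := rB2.hz'
      omega
    have hyx := r2.hy.2.1
    have hyy := r1.hy.2.1
    have hms : IsMS X := by
      intro r hr
      have hr' : r ∈ m + filt M := by rw [← hX]; simp [hr]
      rw [Multiset.mem_add] at hr'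
      rcases hr' with hr' | hr'
      · exact hm r hr'
      · exact (Multiset.mem_filter.1 hr').2
    have cnt : ∀ s e, s ≤ e → X.count (s, e) + (mRange m a b).count (s, e) =
        m.count (s, e) + M.count (s, e) := by
      intro s e hse
      rw [← Multiset.count_add, hX, Multiset.count_add]
      unfold filt
      rw [Multiset.count_filter_of_pos (by simpa using hse)]
    have void : ∀ (Y : Multiset Seg) s (t : ℕ), IsMS Y → H - (t : ℤ) < s → col H Y s t = 0 := by
      intro Y s t hY hs
      apply Multiset.count_eq_zero_of_notMem
      intro h
      have := hY _ h
      simp only at this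
      omega
    refine ⟨x, x1, y', by have := rB2.hT'; omega, rB2.hz', r2.hy.clip u2 hx,
      r1.hy.clip u1 (by omega), ?_, ?_, ?_, ?_, ?_, hms, ?_⟩
    · intro t
      by_cases ht : H - (t : ℤ) < a
      · rw [void X a t hms ht, void m a t hm ht, dl_ne (by omega)]
      · have h3 := cnt a (H - t) (by omega)
        have h4 := r1.c0 t
        unfold col at h4 ⊢
        omega
    · intro t
      by_cases ht : H - (t : ℤ) < a + 1
      · rw [void X _ t hms ht, void m _ t hm ht, dl_ne (by omega), dl_ne (by omega)]
      · have h3 := cnt (a + 1) (H - t) (by omega)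
        have h4 := r1.c1 t
        rw [v1] at h4
        unfold col at h4 ⊢
        omega
    · intro t ht
      have h3 := cnt (a + 1 + 1) (H - t) (by omega)
      have h4 := r2.c1 t
      have h5 : Vt H (a + 1) b t = 0 := by
        unfold Vt
        split_ifs with h6
        · exact dl_ne (by omega)
        · rfl
      have h6 := e1 (a + 1 + 1) (H - t) (by omega)
      rw [h5, q2] at h4
      unfold col at h4 ⊢
      omega
    · intro s e hs
      have hnr : (mRange m a b).count (s, e) = 0 := by
        apply Multiset.count_eq_zero_of_notMem
        intro h
        have := h1.rng _ h
        simp only at this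
        omega
      by_cases hse : s ≤ e
      · have h3 := cnt s e hse
        have hM0 : M.count (s, e) = 0 := by
          apply Multiset.count_eq_zero_of_notMem
          intro h
          have := (hP.ge (s := a) (by omega) (fun r hr => (h1.rng r hr).1)).2 _ h
          simp only at this
          omega
        omega
      · rw [Multiset.count_eq_zero_of_notMem, Multiset.count_eq_zero_of_notMem]
        · exact fun h => hse (hm _ h)
        · exact fun h => hse (hms _ h)
    · intro s e hs hse
      have h3 := cnt s e hse
      rw [e1 s e (by omega), e2 s e (by omega), h1.hi s e (by omega), h2.hi s e (by omega)] at h3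
      exact h3
    · intro r hr
      have hr' : r ∈ m + filt M := by rw [← hX]; simp [hr]
      rw [Multiset.mem_add] at hr'
      rcases hr' with hr' | hr'
      · exact hH r hr'
      · exact hP.M_le (fun r hr => (h1.rng r hr).2.2.2) r (Multiset.mem_filter.1 hr').1
  · intro x y y' hT2 hz hy hy'
    have hx : x ≤ (H - b).toNat := by omega
    have hyx := hy.2.1
    have hy := hy.clip (fun t ht => (u2 t ht).symm) hx
    have hy' := hy'.clip (fun t ht => (u1 t ht).symm) (by omega)
    obtain ⟨e2, r2⟩ := r2
    have hT : T = a := by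
      rcases r2 with r2 | ⟨x1, rB2, r2 | ⟨y1, r2⟩⟩
      · have := r2.hT'
        omega
      · have : x1 = x := by
          have := rB2.hz'
          omega
        subst this
        have := r2.hy y hy.2.1
        have := hy.1
        omega
      · have : x1 = x := by
          have := rB2.hz'
          omega
        subst this
        have := r2.hy.unique hy
        subst this
        obtain ⟨e1, r1⟩ := r1
        rcases r1 with r1 | ⟨x2, rB, r1 | ⟨y2, r1⟩⟩
        · have := r1.hT'
          have := r2.hT
          omega
        · have : x2 = y1 := by
            have := rB.hz'
            have := r2.hz
            omega
          subst this
          have := r1.hy y' hy'.2.1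
          have := hy'.1
          omega
        · exact r1.hT
    have hle : mRange m a b ≤ m := Multiset.filter_le _ _
    have : DLang a b m = some ((m - mRange m a b) + filt M) := by
      rw [DLang_iff hm hab hP]
      refine ⟨hT, ?_⟩
      rw [add_right_comm, tsub_add_cancel_of_le hle]
    rw [this]
    simp

structure DR (H c : ℤ) (m X : Multiset Seg) (d : ℕ) : Prop where
  c1 : ∀ t, col H X c t + dl d t = col H m c t
  c2 : ∀ t, t < (H - c).toNat → col H X (c + 1) t = col H m (c + 1) t + dl d t
  oth : ∀ s e, s ≠ c → s ≠ c + 1 → X.count (s, e) = m.count (s, e)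
  ms : IsMS X
  le : ∀ r ∈ X, r.2 ≤ H

lemma count_push_ne {m : Multiset Seg} {x y s e : ℤ} (h : s ≠ x) :
    (pushSeg m x y).count (s, e) = m.count (s, e) := by
  unfold pushSeg
  split_ifs
  · rw [Multiset.count_add, Multiset.count_singleton, if_neg]
    · rfl
    · intro h2
      exact h (congrArg Prod.fst h2)
  · rfl

lemma DR_of {H c : ℤ} {m : Multiset Seg} (hm : IsMS m) (hH : ∀ r ∈ m, r.2 ≤ H) {d : ℕ}
    (hd : 0 < uu (col H m c) (col H m (c + 1)) d) :
    DR H c m (pushSeg (m.erase (c, H - (d : ℤ))) (c + 1) (H - d)) d := by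
  have hmem : (c, H - (d : ℤ)) ∈ m := by
    rw [mem_col]
    unfold uu at hd
    omega
  refine ⟨?_, ?_, ?_, ?_, ?_⟩
  · intro t
    rw [← col_erase H m c d t hmem]
    unfold col
    rw [count_push_ne (by omega)]
  · intro t ht
    unfold col pushSeg
    split_ifs with h
    · rw [Multiset.count_add, count_erase_other (by omega), Multiset.count_singleton]
      unfold dl
      congr 1
      apply if_congr _ rfl rfl
      simp only [Prod.mk.injEq, true_and]
      omega
    · rw [count_erase_other (by omega), dl_ne (by omega)]
      rfl
  · intro s e h1 h2
    rw [count_push_ne h2, count_erase_other h1]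
  · intro r hr
    unfold pushSeg at hr
    split_ifs at hr with h
    · rw [Multiset.mem_add, Multiset.mem_singleton] at hr
      rcases hr with hr | rfl
      · exact hm r (Multiset.mem_of_mem_erase hr)
      · exact h
    · exact hm r (Multiset.mem_of_mem_erase hr)
  · intro r hr
    unfold pushSeg at hr
    split_ifs at hr with h
    · rw [Multiset.mem_add, Multiset.mem_singleton] at hr
      rcases hr with hr | rfl
      · exact hH r (Multiset.mem_of_mem_erase hr)
      · simp
    · exact hH r (Multiset.mem_of_mem_erase hr)

lemma n2_col {H a b : ℤ} (hab : a < b) (hb : b ≤ H) {m : Multiset Seg} 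
    {n1 n2 : Multiset Seg} (h1 : Hat H a b (mRange m a b) n1)
    (h2 : Hat H (a + 1) b n1 n2) : ∀ t ≤ (H - b).toNat, col H n2 (a + 1 + 1) t =
      ff (ff (col H m a) (col H m (a + 1))) (col H m (a + 1 + 1)) t := by
  have k0 := mRange_col (H := H) (a := a) (b := b) (s := a) (m := m) (by omega) (by omega) hb
  have k1 := mRange_col (H := H) (a := a) (b := b) (s := a + 1) (m := m) (by omega) (by omega) hb
  have k2 := mRange_col (H := H) (a := a) (b := b) (s := a + 1 + 1) (m := m) (by omega)
    (by omega) hb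
  intro t ht
  rw [h2.f]
  revert t
  apply ff_clip
  · intro t ht
    rw [h1.f, ff_clip k0 k1 t ht]
  · intro t ht
    rw [← k2 t ht]
    exact (h1.hi _ _ (by omega)).symm

lemma same2 {H a b : ℤ} (hab : a < b) (hb : b ≤ H) {m m1 : Multiset Seg} {d : ℕ}
    (hd : 0 < uu (col H m (a + 1)) (col H m (a + 1 + 1)) d)
    (hd0 : ∀ t, d < t → uu (col H m (a + 1)) (col H m (a + 1 + 1)) t = 0)
    (hD : DR H (a + 1) m m1 d)
    {n1 n2 : Multiset Seg} (h1 : Hat H a b (mRange m a b) n1) (h2 : Hat H (a + 1) b n1 n2)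
    {n1' n2' : Multiset Seg} (h1' : Hat H a b (mRange m1 a b) n1') (h2' : Hat H (a + 1) b n1' n2')
    {T2 z2 : ℤ} {M2 : Multiset Seg} (hP : Phi b n2 T2 z2 M2)
    {T2' z2' : ℤ} {M2' : Multiset Seg} (hP' : Phi b n2' T2' z2' M2') :
    T2 = T2' ∧ z2 = z2' ∧ ∀ r, M2.count r + n2'.count r = M2'.count r + n2.count r := by
  by_cases hba : b = a + 1
  · obtain ⟨t1, t2, t3⟩ := hP.triv (fun r hr => by have := h2.rng' r hr; omega)
    obtain ⟨t1', t2', t3'⟩ := hP'.triv (fun r hr => by have := h2'.rng' r hr; omega)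
    subst t1 t2 t3 t1' t2' t3'
    exact ⟨rfl, rfl, fun r => by omega⟩
  · have hn : n2 = n2' := by
      rw [Multiset.ext]
      rintro ⟨s, e⟩
      by_cases hbad : s < a + 2 ∨ H < e ∨ e < b
      · rw [Multiset.count_eq_zero_of_notMem, Multiset.count_eq_zero_of_notMem]
        · intro h
          have := h2'.rng' _ h
          simp only at this
          omega
        · intro h
          have := h2.rng' _ h
          simp only at this
          omega
      · push Not at hbad
        by_cases hs : s = a + 2
        · obtain ⟨t, rfl⟩ := idx hbad.2.1
          have e1 := n2_col hab hb h1 h2 t (by omega)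
          have e2 := n2_col hab hb h1' h2' t (by omega)
          have hc0 : col H m1 a = col H m a := by
            funext t
            exact hD.oth _ _ (by omega) (by omega)
          have := D_g (c0 := col H m a) hd hd0 hD.c1 hD.c2 (t := t) (by omega)
          rw [hc0] at e2
          unfold ff at e1 e2 this
          rw [this, ← e1] at e2
          have hs' : s = a + 1 + 1 := by omega
          subst hs'
          exact e2.symm
        · rw [← h2.hi s e (by omega), ← h2'.hi s e (by omega), ← h1.hi s e (by omega),
            ← h1'.hi s e (by omega)]
          unfold mRange
          rw [Multiset.count_filter, Multiset.count_filter, hD.oth s e (by omega) (by omega)]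
    subst hn
    obtain ⟨e1, e2, e3⟩ := hP.unique hP'
    subst e3
    exact ⟨e1, e2, fun r => rfl⟩

lemma final_eq {H a b : ℤ} {m m1 X Y W n2 n2' M2 M2' : Multiset Seg} {d d' x y y' yy : ℕ}
    (hm1 : DR H (a + 1) m m1 d) (hW : DR H (a + 1) X W d') (hX : Res H a m n2 M2 X x y y')
    (hY : Res H a m1 n2' M2' Y x yy y')
    (hM : ∀ r, M2.count r + n2'.count r = M2'.count r + n2.count r)
    (hc : (yy = y ∧ d' = d) ∨ (y = d ∧ d' = yy)) : W = Y := by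
  rw [Multiset.ext]
  rintro ⟨s, e⟩
  by_cases hbad : e < s ∨ H < e
  · rw [Multiset.count_eq_zero_of_notMem, Multiset.count_eq_zero_of_notMem]
    · intro h
      have := hY.ms _ h
      have := hY.le _ h
      simp only at *
      omega
    · intro h
      have := hW.ms _ h
      have := hW.le _ h
      simp only at *
      omega
  · push Not at hbad
    obtain ⟨t, rfl⟩ := idx hbad.2
    rcases lt_trichotomy s a with hs | hs | hs
    · rw [hW.oth _ _ (by omega) (by omega), hX.lo _ _ hs, hY.lo _ _ hs,
        hm1.oth _ _ (by omega) (by omega)]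
    · subst hs
      rw [hW.oth _ _ (by omega) (by omega)]
      have e1 := hX.c0 t
      have e2 := hY.c0 t
      have e3 := hm1.oth s (H - t) (by omega) (by omega)
      unfold col at e1 e2
      omega
    · by_cases hs1 : s = a + 1
      · subst hs1
        have e1 := hX.c1 t
        have e2 := hY.c1 t
        have e3 := hm1.c1 t
        have e4 := hW.c1 t
        unfold col at e1 e2 e3 e4
        rcases hc with ⟨rfl, rfl⟩ | ⟨rfl, rfl⟩ <;> omega
      · by_cases hs2 : s = a + 1 + 1
        · subst hs2
          have e1 := hX.c2 t (by omega)
          have e2 := hY.c2 t (by omega)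
          have e3 := hm1.c2 t (by omega)
          have e4 := hW.c2 t (by omega)
          unfold col at e1 e2 e3 e4
          rcases hc with ⟨rfl, rfl⟩ | ⟨rfl, rfl⟩ <;> omega
        · have e1 := hX.hi s (H - t) (by omega) (by omega)
          have e2 := hY.hi s (H - t) (by omega) (by omega)
          have e3 := hm1.oth s (H - t) (by omega) (by omega)
          have e4 := hW.oth s (H - t) (by omega) (by omega)
          have e5 := hM (s, H - (t : ℤ))
          omega

lemma exists_top (m : Multiset Seg) (b : ℤ) : ∃ H, b ≤ H ∧ ∀ r ∈ m, r.2 ≤ H := by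
  induction m using Multiset.induction with
  | empty => exact ⟨b, le_rfl, by simp⟩
  | cons r m ih =>
    obtain ⟨H, h1, h2⟩ := ih
    refine ⟨max H r.2, by omega, fun q hq => ?_⟩
    rcases Multiset.mem_cons.1 hq with rfl | hq
    · omega
    · have := h2 q hq
      omega

theorem main_aux (m : Multiset Seg) (hm : IsMS m) (a b : ℤ) (hab : a < b) (m1 : Multiset Seg)
    (hD : Drho (a + 1) m = some m1) :
    (∀ X, DLang a b m = some X → ∃ W, Drho (a + 1) X = some W ∧ DLang a b m1 = some W) ∧
    (DLang a b m1 ≠ none → DLang a b m ≠ none) := by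
  obtain ⟨H, hb, hH⟩ := exists_top m b
  rw [Drho_iff hm hH] at hD
  obtain ⟨d, hd, hd0, rfl⟩ := hD
  have hR := DR_of hm hH hd
  generalize pushSeg (m.erase (a + 1, H - (d : ℤ))) (a + 1 + 1) (H - d) = m1 at hR ⊢
  obtain ⟨n1, h1⟩ := exists_Hat (H := H) hab.le (mRange_rng (a := a) (b := b) hH)
  obtain ⟨n2, h2⟩ := exists_Hat (H := H) (by omega) h1.rng'
  obtain ⟨n1', h1'⟩ := exists_Hat (H := H) hab.le (mRange_rng (a := a) (b := b) hR.le)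
  obtain ⟨n2', h2'⟩ := exists_Hat (H := H) (by omega) h1'.rng'
  obtain ⟨T2, z2, M2, hP⟩ := exists_Phi b _ n2 le_rfl (fun r hr => (h2.rng' r hr).2.1)
  obtain ⟨T2', z2', M2', hP'⟩ := exists_Phi b _ n2' le_rfl (fun r hr => (h2'.rng' r hr).2.1)
  obtain ⟨eT, ez, eM⟩ := same2 hab hb hd hd0 hR h1 h2 h1' h2' hP hP'
  subst eT ez
  have hz2 := hP.z_le hb (fun r hr => (h2.rng' r hr).2.2)
  obtain ⟨A1, A2⟩ := DLang_res hab hb hm hH h1 h2 hP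
  obtain ⟨B1, B2⟩ := DLang_res hab hb hR.ms hR.le h1' h2' hP'
  have hc0 : col H m1 a = col H m a := by
    funext t
    exact hR.oth _ _ (by omega) (by omega)
  rw [hc0] at B1 B2
  have hK : ∀ t, (H - (a + 1)).toNat < t → col H m (a + 1) t = 0 := by
    intro t ht
    apply Multiset.count_eq_zero_of_notMem
    intro h
    have := hm _ h
    simp only at this
    omega
  constructor
  · intro X hX
    obtain ⟨x, y, y', hT, hz, hy, hy', rX⟩ := A1 X hX
    obtain ⟨yy, d', l1, l2, l3, l4, l5⟩ := loc1 (K := (H - (a + 1)).toNat) hK (x := x) (by omega)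
      hd hd0 hR.c1 hR.c2 hy hy' rX.c1 rX.c2
    have hne := B2 x yy y' hT hz l1 l2
    obtain ⟨Y, hY⟩ := Option.ne_none_iff_exists'.1 hne
    obtain ⟨x1, y1, y1', -, hz1, hy1, hy1', rY⟩ := B1 Y hY
    have : x1 = x := by omega
    subst this
    have := hy1.unique l1
    subst this
    have := hy1'.unique l2
    subst this
    have hW := DR_of rX.ms rX.le l3
    have hE := final_eq (b := b) hR hW rX rY eM l5
    refine ⟨Y, ?_, hY⟩
    rw [Drho_iff rX.ms rX.le]
    exact ⟨d', l3, l4, hE.symm⟩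
  · intro hne
    obtain ⟨Y, hY⟩ := Option.ne_none_iff_exists'.1 hne
    obtain ⟨x, yy, y', hT, hz, hy, hy', rY⟩ := B1 Y hY
    obtain ⟨y, z, l1, l2⟩ := loc2 (K := (H - (a + 1)).toNat) hK (x := x) (by omega)
      hd hd0 hR.c1 hR.c2 hy hy'
    exact A2 x y z hT hz l1 l2

/-- if `a < b` and `𝒟_{[a+1]}(m) ≠ ∞` then (i) whenever
`𝒟^Lang_{[a,b]}(m) ≠ ∞`, `𝒟_{[a+1]} ∘ 𝒟^Lang_{[a,b]}(m) =
𝒟^Lang_{[a,b]} ∘ 𝒟_{[a+1]}(m) ≠ ∞`; and (ii) if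
`𝒟^Lang_{[a,b]} ∘ 𝒟_{[a+1]}(m) ≠ ∞` then `𝒟^Lang_{[a,b]}(m) ≠ ∞`. -/
theorem stmt4 (m : Multiset Seg) (hm : IsMS m) (a b : ℤ) (hab : a < b)
    (hD : Drho (a + 1) m ≠ none) :
    (DLang a b m ≠ none →
      (DLang a b m).bind (Drho (a + 1)) = (Drho (a + 1) m).bind (DLang a b) ∧
        (DLang a b m).bind (Drho (a + 1)) ≠ none) ∧
    ((Drho (a + 1) m).bind (DLang a b) ≠ none → DLang a b m ≠ none) := by
  obtain ⟨m1, h1⟩ := Option.ne_none_iff_exists'.1 hD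
  obtain ⟨A, B⟩ := main_aux m hm a b hab m1 h1
  constructor
  · intro h
    obtain ⟨X, hX⟩ := Option.ne_none_iff_exists'.1 h
    obtain ⟨W, h2, h3⟩ := A X hX
    rw [hX, h1]
    simp only [Option.bind_some]
    rw [h2, h3]
    simp
  · rw [h1]
    exact B

end Multiseg
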